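/- arXiv:1107.4736 — 2 statements merged into one kernel-verified Lean document; each statement's English description precedes it below -/
import Mathlib

section
/- Let T be an expanding Markov map with repeller Λ and associated iterated function system {φ_i}_{i∈A}. Suppose that {φ_i}_{i∈A} has positive upper cylinder density at y ∈ closure(Λ). Then for every non-negative potential φ : Λ → ℝ satisfying the tempered distortion condition, dim D_y(φ) ≥ s(φ). -/
open Set Filter Topology

/-- An expanding Markov map with countably many inverse branches: a countable family
`{V i}` of pairwise disjoint subintervals of `[0,1]` with nonempty interior, and a map `T`
(given here as a global function `ℝ → ℝ`, only its behaviour on `⋃ i, V i` matters) which is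
`C¹` on each `V i` with derivative `T'`, maps the interior of each `V i` onto `(0,1)`, is
uniformly expanding, and has tempered distortion of the derivative. -/
structure ExpandingMarkovMap (A : Type) : Type where
  countable : Countable A
  nontriv : ∃ i j : A, i ≠ j
  V : A → Set ℝ
  T : ℝ → ℝ
  T' : ℝ → ℝ
  V_subset : ∀ i, V i ⊆ Icc (0:ℝ) 1
  V_ordConnected : ∀ i, (V i).OrdConnected
  V_interior_nonempty : ∀ i, (interior (V i)).Nonempty
  V_disjoint : Pairwise (Function.onFun Disjoint V)
  T_mapsTo : ∀ i, MapsTo T (V i) (Icc (0:ℝ) 1)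
  T_C1 : ∀ i, ContDiffOn ℝ 1 T (V i)
  T_hasDeriv : ∀ i, ∀ x ∈ V i, HasDerivWithinAt T (T' x) (V i) x
  T_maps_interior : ∀ i, T '' interior (V i) = Ioo (0:ℝ) 1
  expanding : ∃ ξ > (1:ℝ), ∃ N : ℕ, ∀ n, N ≤ n → ∀ ω : Fin n → A, ∀ x : ℝ,
    (∀ ν : Fin n, T^[(ν : ℕ)] x ∈ V (ω ν)) →
    ξ ^ n < ∏ l ∈ Finset.range n, |T' (T^[l] x)|
  distortion : ∃ ρ : ℕ → ℝ, Tendsto ρ atTop (𝓝 0) ∧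
    ∀ n : ℕ, ∀ ω : Fin n → A, ∀ x y : ℝ,
      (∀ ν : Fin n, T^[(ν : ℕ)] x ∈ V (ω ν)) → (∀ ν : Fin n, T^[(ν : ℕ)] y ∈ V (ω ν)) →
      Real.exp (-(n : ℝ) * ρ n) ≤
          (∏ l ∈ Finset.range n, |T' (T^[l] x)|) / (∏ l ∈ Finset.range n, |T' (T^[l] y)|) ∧
        (∏ l ∈ Finset.range n, |T' (T^[l] x)|) / (∏ l ∈ Finset.range n, |T' (T^[l] y)|) ≤
          Real.exp ((n : ℝ) * ρ n)

namespace ExpandingMarkovMap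

variable {A : Type} (M : ExpandingMarkovMap A)

/-- The cylinder `V_ω = ⋂_{ν<n} T^{-ν}(V_{ω_ν})` associated to a word `ω ∈ A^n`. -/
def cylinder {n : ℕ} (ω : Fin n → A) : Set ℝ :=
  {x | ∀ ν : Fin n, M.T^[(ν : ℕ)] x ∈ M.V (ω ν)}

/-- The repeller `Λ`: the set of points all of whose iterates are well defined. -/
def repeller : Set ℝ := {x | ∀ n : ℕ, M.T^[n] x ∈ ⋃ i, M.V i}

/-- The Birkhoff sum `S_n(f)(x) = ∑_{l<n} f(T^l x)`. -/
def birkhoff (f : ℝ → ℝ) (n : ℕ) (x : ℝ) : ℝ := ∑ l ∈ Finset.range n, f (M.T^[l] x)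

/-- `S_n(f)(ω) = sup { S_n(f)(x) : x ∈ V_ω }` (`f` being a potential on `Λ`). -/
noncomputable def birkhoffSup (f : ℝ → ℝ) {n : ℕ} (ω : Fin n → A) : ℝ :=
  sSup {v | ∃ x ∈ M.cylinder ω ∩ M.repeller, v = M.birkhoff f n x}

/-- The set of values `|f x - f y|` over pairs `x, y` in a common `n`-cylinder. -/
def varSet (f : ℝ → ℝ) (n : ℕ) : Set ℝ :=
  {d | ∃ ω : Fin n → A, ∃ x ∈ M.cylinder ω ∩ M.repeller, ∃ y ∈ M.cylinder ω ∩ M.repeller,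
    d = |f x - f y|}

/-- The `n`-th level variation `var_n(f)`. -/
noncomputable def var (f : ℝ → ℝ) (n : ℕ) : ℝ := sSup (M.varSet f n)

/-- The tempered distortion condition for a potential on `Λ`:
`var_1(f) < ∞` and `n⁻¹ var_n(S_n(f)) → 0`. -/
def Tempered (f : ℝ → ℝ) : Prop :=
  BddAbove (M.varSet f 1) ∧
    Tendsto (fun n : ℕ => M.var (M.birkhoff f n) n / (n : ℝ)) atTop (𝓝 0)

/-- The topological pressure `P(f) = lim_n n⁻¹ log ∑_{ω ∈ Aⁿ} exp S_n(f)(ω)`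
(realised as a `limsup` in `EReal`; the limit exists for tempered potentials). -/
noncomputable def pressure (f : ℝ → ℝ) : EReal :=
  limsup (fun n : ℕ =>
    ((1 / (n : ℝ) : ℝ) : EReal) *
      ENNReal.log (∑' ω : Fin n → A, ENNReal.ofReal (Real.exp (M.birkhoffSup f ω)))) atTop

/-- The potential `ψ = log |T'|`. -/
noncomputable def psi : ℝ → ℝ := fun x => Real.log |M.T' x|

/-- `s(φ) = inf { s : P(-s(ψ+φ)) ≤ 0 }`. -/
noncomputable def sdim (φ : ℝ → ℝ) : ℝ :=
  sInf {s : ℝ | M.pressure (fun x => -s * (M.psi x + φ x)) ≤ 0}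

/-- The shrinking target set `D_y(φ)`. -/
def shrinkingTarget (y : ℝ) (φ : ℝ → ℝ) : Set ℝ :=
  ⋂ m : ℕ, ⋃ n : ℕ, ⋃ _ : m ≤ n,
    {x | x ∈ M.repeller ∧ |M.T^[n] x - y| < Real.exp (-(M.birkhoff φ n x))}

/-- The shrinking target set `S_y(Φ)` for a sequence of radii `Φ`. -/
def shrinkingTargetSeq (y : ℝ) (Φ : ℕ → ℝ) : Set ℝ :=
  ⋂ m : ℕ, ⋃ n : ℕ, ⋃ _ : m ≤ n, {x | x ∈ M.repeller ∧ |M.T^[n] x - y| < Φ n}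

/-- `g` is the iterated function system associated to `M`: `g i` is the inverse branch of
`T` on `V i`, a `C¹` map of `[0,1]` into `closure (V i)` with `g i (T x) = x` on `V i`. -/
def IsIFS (g : A → ℝ → ℝ) : Prop :=
  ∀ i, ContDiffOn ℝ 1 (g i) (Icc (0:ℝ) 1) ∧ MapsTo (g i) (Icc (0:ℝ) 1) (closure (M.V i)) ∧
    ∀ x ∈ M.V i, g i (M.T x) = x

end ExpandingMarkovMap

/-- The composition `φ_τ = φ_{τ_1} ∘ ⋯ ∘ φ_{τ_n}` of the maps of an IFS along a word `τ`. -/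
def ifsWord {A : Type} (g : A → ℝ → ℝ) {n : ℕ} (τ : Fin n → A) : ℝ → ℝ :=
  (List.ofFn fun ν : Fin n => g (τ ν)).foldr (· ∘ ·) id

/-- `C(y,n,r)`: the collection of cylinder sets `φ_τ([0,1])`, `τ ∈ Aⁿ`, contained in `B(y,r)`. -/
def cylinderFamily {A : Type} (g : A → ℝ → ℝ) (y : ℝ) (n : ℕ) (r : ℝ) : Set (Set ℝ) :=
  {S | ∃ τ : Fin n → A, S = ifsWord g τ '' Icc (0:ℝ) 1 ∧ S ⊆ Metric.ball y r}

/-- Positive upper cylinder density of the IFS `g` at `y`. -/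
def HasPUCD {A : Type} (g : A → ℝ → ℝ) (y : ℝ) : Prop :=
  ∃ lam : ℝ → ℕ,
    Tendsto lam (𝓝[>] (0:ℝ)) atTop ∧
    limsup (fun r : ℝ => Real.log r / (lam r : ℝ)) (𝓝[>] (0:ℝ)) < 0 ∧
    0 < limsup (fun r : ℝ =>
        (ENNReal.ofReal r)⁻¹ * ∑' S : cylinderFamily g y (lam r) r, EMetric.diam (S : Set ℝ))
      (𝓝[>] (0:ℝ))

namespace ExpandingMarkovMap

variable {A : Type} (M : ExpandingMarkovMap A)

/-- The cylinder of a finite word, given as a list. -/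
def listCylinder : List A → Set ℝ
  | [] => univ
  | i :: w => M.V i ∩ M.T ⁻¹' listCylinder w

/-- The modulus of the derivative of `T^n`. -/
noncomputable def derivIter (n : ℕ) (x : ℝ) : ℝ := ∏ l ∈ Finset.range n, |M.T' (M.T^[l] x)|

lemma mem_listCylinder_iff (w : List A) (x : ℝ) :
    x ∈ M.listCylinder w ↔ ∀ ν : Fin w.length, M.T^[(ν : ℕ)] x ∈ M.V (w.get ν) := by
  induction w generalizing x with
  | nil => simp [listCylinder]
  | cons i w ih =>
    simp only [listCylinder, mem_inter_iff, mem_preimage, ih]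
    constructor
    · rintro ⟨h0, h1⟩ ν
      refine Fin.cases ?_ ?_ ν
      · simpa using h0
      · intro k
        simpa using h1 k
    · intro h
      exact ⟨by simpa using h ⟨0, by simp⟩, fun k => by simpa using h k.succ⟩

lemma listCylinder_ofFn {n : ℕ} (ω : Fin n → A) :
    M.listCylinder (List.ofFn ω) = M.cylinder ω := by
  ext x
  rw [mem_listCylinder_iff]
  constructor
  · intro h ν
    simpa using h (Fin.cast (by simp) ν)
  · intro h ν
    simpa [Fin.cast] using h (Fin.cast (by simp) ν)

lemma listCylinder_append (w v : List A) :
    M.listCylinder (w ++ v) = M.listCylinder w ∩ M.T^[w.length] ⁻¹' M.listCylinder v := by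
  induction w with
  | nil => simp [listCylinder]
  | cons i w ih =>
    ext x
    simp [listCylinder, ih, and_assoc]

lemma listCylinder_disjoint {w v : List A} (hl : w.length = v.length) (hne : w ≠ v) :
    Disjoint (M.listCylinder w) (M.listCylinder v) := by
  rw [Set.disjoint_left]
  intro x hw hv
  apply hne
  clear hne
  induction w generalizing v x with
  | nil => exact (List.length_eq_zero_iff.1 hl.symm).symm
  | cons i w ih =>
    cases v with
    | nil => simp at hl
    | cons j v =>
      have hij : i = j := by
        by_contra h
        exact Set.disjoint_left.1 (M.V_disjoint h) hw.1 hv.1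
      rw [hij, ih (by simpa using hl) hw.2 hv.2]

lemma derivIter_succ (n : ℕ) (x : ℝ) :
    M.derivIter (n + 1) x = |M.T' x| * M.derivIter n (M.T x) := by
  simp [derivIter, Finset.prod_range_succ', mul_comm]

lemma T'_ne_zero {i : A} {x : ℝ} (hx : x ∈ M.V i) : M.T' x ≠ 0 := by
  intro h
  obtain ⟨ρ, -, hρ⟩ := M.distortion
  have := (hρ 1 (fun _ => i) x x (by intro ν; fin_cases ν; simpa using hx)
    (by intro ν; fin_cases ν; simpa using hx)).1
  simp [h] at this
  exact absurd this (not_le.2 (Real.exp_pos _))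

lemma derivIter_pos {w : List A} {x : ℝ} (hx : x ∈ M.listCylinder w) :
    0 < M.derivIter w.length x := by
  induction w generalizing x with
  | nil => simp [derivIter]
  | cons i w ih =>
    rw [List.length_cons, derivIter_succ]
    exact mul_pos (abs_pos.2 (M.T'_ne_zero hx.1)) (ih hx.2)

lemma exists_distortion : ∃ ρ : ℕ → ℝ, (∀ n, 0 ≤ ρ n) ∧ Tendsto ρ atTop (𝓝 0) ∧
    ∀ (w : List A) (x y : ℝ), x ∈ M.listCylinder w → y ∈ M.listCylinder w →
      M.derivIter w.length x ≤ Real.exp (w.length * ρ w.length) * M.derivIter w.length y := by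
  obtain ⟨ρ, h0, hρ⟩ := M.distortion
  refine ⟨fun n => |ρ n|, fun n => abs_nonneg _, by simpa using h0.abs, fun w x y hx hy => ?_⟩
  have := (hρ w.length w.get x y ((M.mem_listCylinder_iff w x).1 hx)
    ((M.mem_listCylinder_iff w y).1 hy)).2
  change M.derivIter w.length x / M.derivIter w.length y ≤ _ at this
  rw [div_le_iff₀ (M.derivIter_pos hy)] at this
  refine this.trans ?_
  have := (M.derivIter_pos hy).le
  gcongr
  exact le_abs_self _

lemma interior_V_subset (i : A) : interior (M.V i) ⊆ Ioo 0 1 := by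
  rw [← interior_Icc]
  exact interior_mono (M.V_subset i)

end ExpandingMarkovMap

/-- The composition of the maps of an IFS along a finite word, given as a list. -/
def wordMap {A : Type} (g : A → ℝ → ℝ) (w : List A) : ℝ → ℝ := (w.map g).foldr (· ∘ ·) id

/-- The length of the interval `wordMap g w '' [0,1]`. -/
noncomputable def wordLength {A : Type} (g : A → ℝ → ℝ) (w : List A) : ℝ :=
  |wordMap g w 1 - wordMap g w 0|

/-- `κ` is a lower Lipschitz constant of `wordMap g w` on `[0,1]`. -/
def LowerLipschitz {A : Type} (g : A → ℝ → ℝ) (w : List A) (κ : ℝ) : Prop :=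
  ∀ a ∈ Icc (0:ℝ) 1, ∀ b ∈ Icc (0:ℝ) 1, κ * |b - a| ≤ |wordMap g w b - wordMap g w a|

section WordMap

variable {A : Type} (g : A → ℝ → ℝ)

@[simp] lemma wordMap_nil : wordMap g [] = id := rfl

lemma wordMap_cons (i : A) (w : List A) : wordMap g (i :: w) = g i ∘ wordMap g w := rfl

lemma wordMap_append (w v : List A) : wordMap g (w ++ v) = wordMap g w ∘ wordMap g v := by
  induction w with
  | nil => rfl
  | cons i w ih => rw [List.cons_append, wordMap_cons, ih, wordMap_cons, Function.comp_assoc]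

lemma ifsWord_eq_wordMap {n : ℕ} (τ : Fin n → A) : ifsWord g τ = wordMap g (List.ofFn τ) := by
  rw [ifsWord, wordMap, List.map_ofFn]
  rfl

end WordMap

namespace ExpandingMarkovMap

variable {A : Type} {M : ExpandingMarkovMap A} {g : A → ℝ → ℝ}

lemma IsIFS.mapsTo_Icc (hg : M.IsIFS g) (i : A) : MapsTo (g i) (Icc 0 1) (Icc 0 1) := fun _ ht =>
  closure_minimal (M.V_subset i) isClosed_Icc ((hg i).2.1 ht)

lemma IsIFS.apply_Ioo (hg : M.IsIFS g) (i : A) {t : ℝ} (ht : t ∈ Ioo (0:ℝ) 1) :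
    g i t ∈ interior (M.V i) ∧ M.T (g i t) = t := by
  rw [← M.T_maps_interior i] at ht
  obtain ⟨x, hx, rfl⟩ := ht
  rw [(hg i).2.2 x (interior_subset hx)]
  exact ⟨hx, rfl⟩

lemma IsIFS.exists_hasDerivAt (hg : M.IsIFS g) (i : A) {t : ℝ} (ht : t ∈ Ioo (0:ℝ) 1) :
    ∃ d, HasDerivAt (g i) d t ∧ |d| * |M.T' (g i t)| = 1 := by
  obtain ⟨hx, hT⟩ := hg.apply_Ioo i ht
  have hd : DifferentiableAt ℝ (g i) t :=
    ((hg i).1.differentiableOn (by norm_num)).differentiableAt (Icc_mem_nhds ht.1 ht.2)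
  refine ⟨_, hd.hasDerivAt, ?_⟩
  have h1 : HasDerivAt M.T (M.T' (g i t)) (g i t) :=
    (M.T_hasDeriv i _ (interior_subset hx)).hasDerivAt (mem_interior_iff_mem_nhds.1 hx)
  have h2 := h1.comp t hd.hasDerivAt
  have h3 : M.T ∘ g i =ᶠ[𝓝 t] id := by
    filter_upwards [Ioo_mem_nhds ht.1 ht.2] with u hu using (hg.apply_Ioo i hu).2
  have h4 := (h2.congr_of_eventuallyEq h3.symm).unique (hasDerivAt_id t)
  rw [← abs_mul, mul_comm, h4, abs_one]

lemma IsIFS.wordMap_mapsTo (hg : M.IsIFS g) (w : List A) :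
    MapsTo (wordMap g w) (Icc 0 1) (Icc 0 1) := by
  induction w with
  | nil => exact mapsTo_id _
  | cons i w ih => exact (hg.mapsTo_Icc i).comp ih

lemma IsIFS.wordMap_continuousOn (hg : M.IsIFS g) (w : List A) :
    ContinuousOn (wordMap g w) (Icc 0 1) := by
  induction w with
  | nil => exact continuousOn_id
  | cons i w ih => exact (hg i).1.continuousOn.comp ih (hg.wordMap_mapsTo w)

lemma IsIFS.wordMap_Ioo (hg : M.IsIFS g) (w : List A) {t : ℝ} (ht : t ∈ Ioo (0:ℝ) 1) :
    wordMap g w t ∈ Ioo (0:ℝ) 1 ∧ wordMap g w t ∈ M.listCylinder w ∧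
      M.T^[w.length] (wordMap g w t) = t ∧
      ∃ d, HasDerivAt (wordMap g w) d t ∧ |d| * M.derivIter w.length (wordMap g w t) = 1 := by
  induction w with
  | nil => exact ⟨ht, mem_univ _, rfl, 1, hasDerivAt_id t, by simp [derivIter]⟩
  | cons i w ih =>
    obtain ⟨h1, h2, h3, d, h4, h5⟩ := ih
    obtain ⟨h6, h7⟩ := hg.apply_Ioo i h1
    obtain ⟨e, h8, h9⟩ := hg.exists_hasDerivAt i h1
    refine ⟨M.interior_V_subset i h6, ⟨interior_subset h6, ?_⟩, ?_, e * d, h8.comp t h4, ?_⟩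
    · rw [mem_preimage, wordMap_cons, Function.comp_apply, h7]
      exact h2
    · rw [List.length_cons, Function.iterate_succ_apply, wordMap_cons, Function.comp_apply, h7, h3]
    · rw [List.length_cons, derivIter_succ, wordMap_cons, Function.comp_apply, h7, abs_mul]
      linear_combination |e| * |M.T' (g i (wordMap g w t))| * h5 + h9

lemma IsIFS.exists_meanValue (hg : M.IsIFS g) (w : List A) {a b : ℝ} (ha : a ∈ Icc (0:ℝ) 1)
    (hb : b ∈ Icc (0:ℝ) 1) (hab : a ≠ b) :
    ∃ x ∈ M.listCylinder w,
      |wordMap g w b - wordMap g w a| * M.derivIter w.length x = |b - a| := by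
  wlog hlt : a < b generalizing a b
  · obtain ⟨x, hx, h⟩ := this hb ha hab.symm (lt_of_le_of_ne (not_lt.1 hlt) hab.symm)
    exact ⟨x, hx, by rw [abs_sub_comm, h, abs_sub_comm]⟩
  have hsub : ∀ t ∈ Ioo a b, t ∈ Ioo (0:ℝ) 1 := fun t ht =>
    ⟨ha.1.trans_lt ht.1, ht.2.trans_le hb.2⟩
  obtain ⟨c, hc, h⟩ := exists_deriv_eq_slope (wordMap g w) hlt
    ((hg.wordMap_continuousOn w).mono (Icc_subset_Icc ha.1 hb.2))
    (fun _ ht => by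
      obtain ⟨-, -, -, d, hd, -⟩ := hg.wordMap_Ioo w (hsub _ ht)
      exact hd.differentiableAt.differentiableWithinAt)
  obtain ⟨-, h2, -, d, hd, h5⟩ := hg.wordMap_Ioo w (hsub c hc)
  refine ⟨_, h2, ?_⟩
  have hba : b - a ≠ 0 := sub_ne_zero.2 hab.symm
  rw [hd.deriv, eq_div_iff hba] at h
  rw [← h, abs_mul]
  linear_combination |b - a| * h5

lemma IsIFS.wordMap_injOn (hg : M.IsIFS g) (w : List A) : InjOn (wordMap g w) (Icc 0 1) := by
  intro a ha b hb h
  by_contra hab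
  obtain ⟨x, -, hx⟩ := hg.exists_meanValue w ha hb hab
  rw [h, sub_self, abs_zero, zero_mul, eq_comm, abs_eq_zero, sub_eq_zero] at hx
  exact hab hx.symm

lemma IsIFS.wordLength_pos (hg : M.IsIFS g) (w : List A) : 0 < wordLength g w := by
  refine abs_pos.2 (sub_ne_zero.2 fun h => ?_)
  exact one_ne_zero (hg.wordMap_injOn w (right_mem_Icc.2 zero_le_one)
    (left_mem_Icc.2 zero_le_one) h)

lemma IsIFS.image_wordMap (hg : M.IsIFS g) (w : List A) :
    wordMap g w '' Icc 0 1 = uIcc (wordMap g w 0) (wordMap g w 1) := by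
  apply Subset.antisymm
  · rintro _ ⟨t, ht, rfl⟩
    rcases (hg.wordMap_continuousOn w).strictMonoOn_of_injOn_Icc' zero_le_one
      (hg.wordMap_injOn w) with h | h
    · exact Icc_subset_uIcc ⟨h.monotoneOn (left_mem_Icc.2 zero_le_one) ht ht.1,
        h.monotoneOn ht (right_mem_Icc.2 zero_le_one) ht.2⟩
    · exact Icc_subset_uIcc' ⟨h.antitoneOn ht (right_mem_Icc.2 zero_le_one) ht.2,
        h.antitoneOn (left_mem_Icc.2 zero_le_one) ht ht.1⟩
  · have := intermediate_value_uIcc (a := 0) (b := 1) (f := wordMap g w)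
      (by rw [uIcc_of_le zero_le_one]; exact hg.wordMap_continuousOn w)
    rwa [uIcc_of_le zero_le_one] at this

lemma IsIFS.dist_le_wordLength (hg : M.IsIFS g) (w : List A) {x y : ℝ}
    (hx : x ∈ wordMap g w '' Icc 0 1) (hy : y ∈ wordMap g w '' Icc 0 1) :
    |x - y| ≤ wordLength g w := by
  rw [hg.image_wordMap] at hx hy
  rw [wordLength, abs_sub_comm (wordMap g w 1)]
  have := Set.abs_sub_le_of_uIcc_subset_uIcc (uIcc_subset_uIcc hx hy)
  rwa [abs_sub_comm y x, abs_sub_comm (wordMap g w 1)] at this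

/-- The open interval with the same endpoints as `wordMap g w '' [0,1]`. -/
def wordInterior (g : A → ℝ → ℝ) (w : List A) : Set ℝ :=
  Ioo (min (wordMap g w 0) (wordMap g w 1)) (max (wordMap g w 0) (wordMap g w 1))

lemma IsIFS.wordInterior_subset (hg : M.IsIFS g) (w : List A) :
    wordInterior g w ⊆ M.listCylinder w := by
  have : wordInterior g w ⊆ wordMap g w '' Ioo 0 1 := by
    rcases le_total (wordMap g w 0) (wordMap g w 1) with h | h
    · rw [wordInterior, min_eq_left h, max_eq_right h]
      exact intermediate_value_Ioo zero_le_one (hg.wordMap_continuousOn w)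
    · rw [wordInterior, min_eq_right h, max_eq_left h]
      exact intermediate_value_Ioo' zero_le_one (hg.wordMap_continuousOn w)
  intro x hx
  obtain ⟨t, ht, rfl⟩ := this hx
  exact (hg.wordMap_Ioo w ht).2.1

lemma IsIFS.sum_volume_le (hg : M.IsIFS g) {n : ℕ} (S : Finset (List A))
    (hS : ∀ w ∈ S, w.length = n) {W : Set ℝ} (hW : MeasurableSet W) :
    ∑ w ∈ S, MeasureTheory.volume (wordInterior g w ∩ W) ≤ MeasureTheory.volume W := by
  rw [← MeasureTheory.measure_biUnion_finset]
  · exact MeasureTheory.measure_mono (iUnion₂_subset fun _ _ => inter_subset_right)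
  · intro w hw v hv hne
    exact (((M.listCylinder_disjoint ((hS w hw).trans (hS v hv).symm) hne).mono
      (hg.wordInterior_subset w) (hg.wordInterior_subset v))).mono inter_subset_left
      inter_subset_left
  · exact fun w _ => measurableSet_Ioo.inter hW

lemma IsIFS.sum_wordLength_le_one (hg : M.IsIFS g) {n : ℕ} (S : Finset (List A))
    (hS : ∀ w ∈ S, w.length = n) : ∑ w ∈ S, wordLength g w ≤ 1 := by
  have h := hg.sum_volume_le S hS (measurableSet_Icc (a := (0:ℝ)) (b := 1))
  rw [Real.volume_Icc, sub_zero] at h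
  have h2 : ∀ w ∈ S, ENNReal.ofReal (wordLength g w) =
      MeasureTheory.volume (wordInterior g w ∩ Icc 0 1) := by
    intro w _
    have h0 := hg.wordMap_mapsTo w (left_mem_Icc.2 zero_le_one)
    have h1 := hg.wordMap_mapsTo w (right_mem_Icc.2 zero_le_one)
    have : wordInterior g w ⊆ Icc 0 1 := Ioo_subset_Icc_self.trans
      (Icc_subset_Icc (le_min h0.1 h1.1) (max_le h0.2 h1.2))
    rw [inter_eq_left.2 this, wordInterior, Real.volume_Ioo, max_sub_min_eq_abs, wordLength]
  rw [← Finset.sum_congr rfl h2, ← ENNReal.ofReal_sum_of_nonneg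
    (fun w _ => (hg.wordLength_pos w).le)] at h
  exact (ENNReal.ofReal_le_ofReal_iff zero_le_one).1 h

/-- Intervals of a fixed generation that meet an interval of length `d` have, when truncated to
length `d`, total length at most `3 * d`. -/
lemma IsIFS.sum_min_le (hg : M.IsIFS g) {n : ℕ} (S : Finset (List A))
    (hS : ∀ w ∈ S, w.length = n) {x d : ℝ} (hd : 0 < d)
    (hx : ∀ w ∈ S, (wordMap g w '' Icc 0 1 ∩ Icc x (x + d)).Nonempty) :
    ∑ w ∈ S, min (wordLength g w) d ≤ 3 * d := by
  have h := hg.sum_volume_le S hS (measurableSet_Ioo (a := x - d) (b := x + 2 * d))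
  have h2 : ∀ w ∈ S, ENNReal.ofReal (min (wordLength g w) d) ≤
      MeasureTheory.volume (wordInterior g w ∩ Ioo (x - d) (x + 2 * d)) := by
    intro w hw
    obtain ⟨z, hz, hz'⟩ := hx w hw
    rw [hg.image_wordMap, uIcc, mem_Icc] at hz
    rw [wordInterior, Ioo_inter_Ioo, Real.volume_Ioo, wordLength, ← max_sub_min_eq_abs]
    apply ENNReal.ofReal_le_ofReal
    obtain ⟨h1, h2⟩ := hz
    obtain ⟨h3, h4⟩ := hz'
    generalize wordMap g w 0 ⊓ wordMap g w 1 = a at *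
    generalize wordMap g w 0 ⊔ wordMap g w 1 = b at *
    simp only [min_def, max_def]
    split_ifs <;> linarith
  have h3 := (Finset.sum_le_sum h2).trans h
  rw [← ENNReal.ofReal_sum_of_nonneg
    (fun w _ => le_min (hg.wordLength_pos w).le hd.le), Real.volume_Ioo,
    ENNReal.ofReal_le_ofReal_iff (by linarith)] at h3
  linarith

lemma image_wordMap_append_subset (hg : M.IsIFS g) (w v : List A) :
    wordMap g (w ++ v) '' Icc 0 1 ⊆ wordMap g w '' Icc 0 1 := by
  rw [wordMap_append, image_comp]
  exact image_mono (hg.wordMap_mapsTo v).image_subset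

lemma lowerLipschitz_append (hg : M.IsIFS g) {w v : List A} {κ κ' : ℝ} (hκ : 0 ≤ κ)
    (hw : LowerLipschitz g w κ) (hv : LowerLipschitz g v κ') :
    LowerLipschitz g (w ++ v) (κ * κ') := by
  intro a ha b hb
  rw [wordMap_append, Function.comp_apply, Function.comp_apply, mul_assoc]
  exact (mul_le_mul_of_nonneg_left (hv a ha b hb) hκ).trans
    (hw _ (hg.wordMap_mapsTo v ha) _ (hg.wordMap_mapsTo v hb))

lemma lowerLipschitz_nil : LowerLipschitz g [] 1 := fun a _ b _ => by simp

lemma mul_wordLength_le (hg : M.IsIFS g) {w : List A} {κ : ℝ} (hw : LowerLipschitz g w κ)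
    (v : List A) : κ * wordLength g v ≤ wordLength g (w ++ v) := by
  have h := hw _ (hg.wordMap_mapsTo v (left_mem_Icc.2 zero_le_one)) _
    (hg.wordMap_mapsTo v (right_mem_Icc.2 zero_le_one))
  rwa [wordLength, wordLength, wordMap_append]

lemma le_wordLength {w : List A} {κ : ℝ} (hw : LowerLipschitz g w κ) : κ ≤ wordLength g w := by
  simpa [wordLength] using hw 0 (left_mem_Icc.2 zero_le_one) 1 (right_mem_Icc.2 zero_le_one)

lemma lowerLipschitz_of_derivIter_le (hg : M.IsIFS g) {w : List A} {κ : ℝ}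
    (h : ∀ x ∈ M.listCylinder w, κ * M.derivIter w.length x ≤ 1) : LowerLipschitz g w κ := by
  intro a ha b hb
  rcases eq_or_ne a b with rfl | hab
  · simp
  obtain ⟨x, hx, he⟩ := hg.exists_meanValue w ha hb hab
  rw [← he]
  nlinarith [h x hx, abs_nonneg (wordMap g w b - wordMap g w a)]

/-- Bounded distortion along words of length `n`, up to the subexponential factor
`exp (n * ρ n)`. -/
lemma exists_lowerLipschitz_wordLength (hg : M.IsIFS g) : ∃ ρ : ℕ → ℝ, (∀ n, 0 ≤ ρ n) ∧
    Tendsto ρ atTop (𝓝 0) ∧ ∀ w : List A,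
      LowerLipschitz g w (wordLength g w * Real.exp (-(w.length * ρ w.length))) := by
  obtain ⟨ρ, h0, h1, h2⟩ := M.exists_distortion
  refine ⟨ρ, h0, h1, fun w => lowerLipschitz_of_derivIter_le hg fun x hx => ?_⟩
  obtain ⟨z, hz, he⟩ := hg.exists_meanValue w (left_mem_Icc.2 zero_le_one)
    (right_mem_Icc.2 zero_le_one) zero_ne_one
  rw [sub_zero, abs_one] at he
  calc _ ≤ wordLength g w * Real.exp (-(w.length * ρ w.length)) *
        (Real.exp (w.length * ρ w.length) * M.derivIter w.length z) :=
        mul_le_mul_of_nonneg_left (h2 w x z hx hz)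
          (mul_nonneg (hg.wordLength_pos w).le (Real.exp_pos _).le)
    _ = wordLength g w * M.derivIter w.length z *
        (Real.exp (-(w.length * ρ w.length)) * Real.exp (w.length * ρ w.length)) := by ring
    _ = 1 := by rw [← Real.exp_add, neg_add_cancel, Real.exp_zero, mul_one]; exact he

lemma exists_wordLength_lt (hg : M.IsIFS g) {d : ℝ} (hd : 0 < d) :
    ∃ n : ℕ, ∀ w : List A, n ≤ w.length → wordLength g w < d := by
  obtain ⟨ξ, hξ, N, hN⟩ := M.expanding
  obtain ⟨k, hk⟩ := pow_unbounded_of_one_lt d⁻¹ hξ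
  refine ⟨max N k, fun w hw => ?_⟩
  obtain ⟨z, hz, he⟩ := hg.exists_meanValue w (left_mem_Icc.2 zero_le_one)
    (right_mem_Icc.2 zero_le_one) zero_ne_one
  have h1 : ξ ^ w.length < M.derivIter w.length z :=
    hN w.length (le_of_max_le_left hw) w.get z ((M.mem_listCylinder_iff w z).1 hz)
  have h2 : ξ ^ k ≤ ξ ^ w.length := pow_le_pow_right₀ hξ.le (le_of_max_le_right hw)
  rw [sub_zero, abs_one] at he
  change wordLength g w * _ = 1 at he
  have h3 : d⁻¹ < M.derivIter w.length z := by linarith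
  rw [eq_inv_of_mul_eq_one_left he]
  exact inv_lt_of_inv_lt₀ hd h3

end ExpandingMarkovMap

open MeasureTheory

/-- One step of a random coding: a finite set of words of common length `size`, a probability
weight and a lower Lipschitz constant for each of them, and a bound `ratio` for
`weight v / lower v ^ s`. -/
structure CodeStep (A : Type) where
  words : Finset (List A)
  weight : List A → ℝ
  lower : List A → ℝ
  size : ℕ
  ratio : ℝ

/-- The conditions on a coding step that yield the mass bound of exponent `s`. -/
structure CodeStep.Admissible {A : Type} (g : A → ℝ → ℝ) (s C : ℝ) (σ : CodeStep A) : Prop where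
  size_pos : 0 < σ.size
  length_eq : ∀ v ∈ σ.words, v.length = σ.size
  weight_nonneg : ∀ v, 0 ≤ σ.weight v
  sum_weight : ∑ v ∈ σ.words, σ.weight v = 1
  lower_pos : ∀ v, 0 < σ.lower v
  lowerLipschitz : ∀ v ∈ σ.words, LowerLipschitz g v (σ.lower v)
  ratio_nonneg : 0 ≤ σ.ratio
  weight_le : ∀ v ∈ σ.words, σ.weight v ≤ σ.ratio * σ.lower v ^ s
  sum_le : ∀ (w : List A) (κ x d : ℝ), 0 < κ → 0 < d → LowerLipschitz g w κ →
    ∀ S ⊆ σ.words, (∀ v ∈ S, wordLength g (w ++ v) < d ∧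
      (wordMap g (w ++ v) '' Icc 0 1 ∩ Icc x (x + d)).Nonempty) →
    ∑ v ∈ S, σ.weight v ≤ C * (d / κ) ^ s * σ.ratio

/-- The space of infinite sequences of words allowed by a sequence of coding steps. -/
abbrev Code {A : Type} (σ : ℕ → CodeStep A) : Type := ∀ j, {v : List A // v ∈ (σ j).words}

namespace Code

variable {A : Type} {σ : ℕ → CodeStep A}

/-- The concatenation of the first `j` words of a code. -/
def word (ω : Code σ) : ℕ → List A
  | 0 => []
  | j + 1 => word ω j ++ (ω j : List A)

/-- The product of the lower Lipschitz constants of the first `j` words of a code. -/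
noncomputable def lower (ω : Code σ) (j : ℕ) : ℝ := ∏ i ∈ Finset.range j, (σ i).lower (ω i)

/-- The product of the weights of the first `j` words of a code. -/
noncomputable def weight (ω : Code σ) (j : ℕ) : ℝ := ∏ i ∈ Finset.range j, (σ i).weight (ω i)

lemma finite_range_word (σ : ℕ → CodeStep A) (j : ℕ) :
    (range fun ω : Code σ => ω.word j).Finite := by
  induction j with
  | zero => exact (finite_singleton []).subset (by rintro _ ⟨ω, rfl⟩; rfl)
  | succ j ih =>
    refine (Set.Finite.image2 (· ++ ·) ih (σ j).words.finite_toSet).subset ?_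
    rintro _ ⟨ω, rfl⟩
    exact ⟨_, ⟨ω, rfl⟩, _, (ω j).2, rfl⟩

variable {M : ExpandingMarkovMap A} {g : A → ℝ → ℝ} {s C : ℝ}

lemma length_word (hσ : ∀ j, (σ j).Admissible g s C) (ω : Code σ) (j : ℕ) :
    (ω.word j).length = ∑ i ∈ Finset.range j, (σ i).size := by
  induction j with
  | zero => rfl
  | succ j ih =>
    rw [word, List.length_append, ih, Finset.sum_range_succ, (hσ j).length_eq _ (ω j).2]

lemma le_length_word (hσ : ∀ j, (σ j).Admissible g s C) (ω : Code σ) (j : ℕ) :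
    j ≤ (ω.word j).length := by
  rw [length_word hσ]
  calc j = ∑ i ∈ Finset.range j, 1 := by simp
    _ ≤ _ := Finset.sum_le_sum fun i _ => (hσ i).size_pos

lemma eq_of_word_eq (hσ : ∀ j, (σ j).Admissible g s C) {ω ω' : Code σ} {j : ℕ}
    (h : ω.word j = ω'.word j) : ∀ i < j, ω i = ω' i := by
  induction j with
  | zero => intro i hi; omega
  | succ j ih =>
    obtain ⟨h1, h2⟩ := List.append_inj h (by rw [length_word hσ, length_word hσ])
    intro i hi
    rcases Nat.lt_succ_iff_lt_or_eq.1 hi with hi | rfl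
    · exact ih h1 i hi
    · exact Subtype.ext h2

lemma lower_pos (hσ : ∀ j, (σ j).Admissible g s C) (ω : Code σ) (j : ℕ) : 0 < ω.lower j :=
  Finset.prod_pos fun i _ => (hσ i).lower_pos _

lemma lowerLipschitz_word (hg : M.IsIFS g) (hσ : ∀ j, (σ j).Admissible g s C) (ω : Code σ)
    (j : ℕ) : LowerLipschitz g (ω.word j) (ω.lower j) := by
  induction j with
  | zero => simpa [word, lower] using ExpandingMarkovMap.lowerLipschitz_nil
  | succ j ih =>
    rw [word, lower, Finset.prod_range_succ]
    exact ExpandingMarkovMap.lowerLipschitz_append hg (lower_pos hσ ω j).le ih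
      ((hσ j).lowerLipschitz _ (ω j).2)

lemma weight_le (hσ : ∀ j, (σ j).Admissible g s C) (ω : Code σ) (j : ℕ) :
    ω.weight j ≤ (∏ i ∈ Finset.range j, (σ i).ratio) * ω.lower j ^ s := by
  rw [lower, ← Real.finsetProd_rpow _ _ fun i _ => ((hσ i).lower_pos _).le, weight,
    ← Finset.prod_mul_distrib]
  exact Finset.prod_le_prod (fun i _ => (hσ i).weight_nonneg _)
    fun i _ => (hσ i).weight_le _ (ω i).2

/-- The distribution of the `j`-th word of a random code. -/
noncomputable def stepMeasure [MeasurableSpace (List A)] (σ : ℕ → CodeStep A) (j : ℕ) :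
    Measure {v : List A // v ∈ (σ j).words} :=
  ∑ v : {v : List A // v ∈ (σ j).words}, ENNReal.ofReal ((σ j).weight v) • Measure.dirac v

lemma isProbabilityMeasure_stepMeasure [MeasurableSpace (List A)]
    (hσ : ∀ j, (σ j).Admissible g s C) (j : ℕ) : IsProbabilityMeasure (stepMeasure σ j) := by
  constructor
  simp only [stepMeasure, Measure.coe_finsetSum, Finset.sum_apply, Measure.smul_apply,
    measure_univ, smul_eq_mul, mul_one]
  rw [← ENNReal.ofReal_sum_of_nonneg fun v _ => (hσ j).weight_nonneg _,
    Finset.sum_coe_sort (σ j).words (σ j).weight, (hσ j).sum_weight, ENNReal.ofReal_one]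

lemma stepMeasure_le [MeasurableSpace (List A)] [MeasurableSingletonClass (List A)]
    (j : ℕ) (v : List A) :
    stepMeasure σ j {a | (a : List A) = v} ≤ ENNReal.ofReal ((σ j).weight v) := by
  classical
  simp only [stepMeasure, Measure.coe_finsetSum, Finset.sum_apply, Measure.smul_apply, smul_eq_mul]
  have : ∀ a : {v : List A // v ∈ (σ j).words},
      ENNReal.ofReal ((σ j).weight a) * Measure.dirac a {b | (b : List A) = v} =
      if (a : List A) = v then ENNReal.ofReal ((σ j).weight v) else 0 := by
    intro a
    rw [Measure.dirac_apply' _ (toFinite _).measurableSet]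
    by_cases h : (a : List A) = v
    · simp [indicator, h]
    · simp [indicator, h]
  simp only [this]
  rw [Finset.sum_coe_sort (σ j).words
    (fun a => if a = v then ENNReal.ofReal ((σ j).weight v) else 0), Finset.sum_ite_eq']
  split_ifs <;> simp

lemma measure_cylinder_le [MeasurableSpace (List A)] [MeasurableSingletonClass (List A)]
    (hσ : ∀ j, (σ j).Admissible g s C) [∀ j, IsProbabilityMeasure (stepMeasure σ j)]
    (ω : Code σ) (j : ℕ) (v : List A) :
    Measure.infinitePi (stepMeasure σ) {ω' | (∀ i < j, ω' i = ω i) ∧ (ω' j : List A) = v} ≤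
      ENNReal.ofReal (ω.weight j * (σ j).weight v) := by
  have hsub : {ω' : Code σ | (∀ i < j, ω' i = ω i) ∧ (ω' j : List A) = v} ⊆
      Set.pi (Finset.range (j + 1) : Set ℕ)
        fun i => {a | (a : List A) = if i < j then (ω i : List A) else v} := by
    rintro ω' ⟨h1, h2⟩ i hi
    rw [Finset.coe_range, mem_Iio, Nat.lt_succ_iff_lt_or_eq] at hi
    rcases hi with hi | rfl
    · simp [hi, h1 i hi]
    · simp [h2]
  refine (measure_mono hsub).trans ?_
  rw [Measure.infinitePi_pi _ fun i _ => (toFinite _).measurableSet, weight,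
    ENNReal.ofReal_mul (Finset.prod_nonneg fun i _ => (hσ i).weight_nonneg _),
    ENNReal.ofReal_prod_of_nonneg fun i _ => (hσ i).weight_nonneg _, Finset.prod_range_succ]
  gcongr with i hi
  · rw [if_pos (Finset.mem_range.1 hi)]
    exact stepMeasure_le i _
  · rw [if_neg (lt_irrefl j)]
    exact stepMeasure_le j _

/-- The codes whose `j`-th interval has length at least `d`, while the next one is shorter and
meets `[x, x + d]`. -/
def stopping (g : A → ℝ → ℝ) (σ : ℕ → CodeStep A) (x d : ℝ) (j : ℕ) : Set (Code σ) :=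
  {ω | d ≤ wordLength g (ω.word j) ∧ wordLength g (ω.word (j + 1)) < d ∧
    (wordMap g (ω.word (j + 1)) '' Icc 0 1 ∩ Icc x (x + d)).Nonempty}

lemma measure_stopping_le [MeasurableSpace (List A)] [MeasurableSingletonClass (List A)]
    (hg : M.IsIFS g) (hC : 0 ≤ C)
    (hσ : ∀ j, (σ j).Admissible g s C) [∀ j, IsProbabilityMeasure (stepMeasure σ j)]
    (x : ℝ) {d : ℝ} (hd : 0 < d) (j : ℕ) :
    Measure.infinitePi (stepMeasure σ) (stopping g σ x d j) ≤
      ENNReal.ofReal (3 * (C * d ^ s * ∏ i ∈ Finset.range (j + 1), (σ i).ratio)) := by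
  classical
  have hfin : ((fun ω : Code σ => ω.word j) '' stopping g σ x d j).Finite :=
    (finite_range_word σ j).subset (image_subset_range _ _)
  set K := C * d ^ s * ∏ i ∈ Finset.range (j + 1), (σ i).ratio with hK
  have hK0 : 0 ≤ K := mul_nonneg (mul_nonneg hC (Real.rpow_nonneg hd.le _))
    (Finset.prod_nonneg fun i _ => (hσ i).ratio_nonneg)
  have hcard : (hfin.toFinset.card : ℝ) ≤ 3 := by
    have h := hg.sum_min_le hfin.toFinset (n := ∑ i ∈ Finset.range j, (σ i).size) (x := x)
      (d := d) ?_ hd ?_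
    · rw [Finset.sum_congr rfl (g := fun _ => d), Finset.sum_const, nsmul_eq_mul] at h
      · exact le_of_mul_le_mul_right h hd
      · intro w hw
        obtain ⟨ω, hω, rfl⟩ := hfin.mem_toFinset.1 hw
        exact min_eq_right hω.1
    · intro w hw
      obtain ⟨ω, hω, rfl⟩ := hfin.mem_toFinset.1 hw
      exact length_word hσ ω j
    · intro w hw
      obtain ⟨ω, hω, rfl⟩ := hfin.mem_toFinset.1 hw
      exact hω.2.2.mono (inter_subset_inter_left _
        (ExpandingMarkovMap.image_wordMap_append_subset hg _ _))
  have hcover : stopping g σ x d j ⊆ ⋃ w ∈ hfin.toFinset,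
      {ω : Code σ | ω ∈ stopping g σ x d j ∧ ω.word j = w} := by
    intro ω hω
    exact mem_iUnion₂.2 ⟨ω.word j, hfin.mem_toFinset.2 ⟨ω, hω, rfl⟩, hω, rfl⟩
  have hpart : ∀ w ∈ hfin.toFinset, Measure.infinitePi (stepMeasure σ)
      {ω : Code σ | ω ∈ stopping g σ x d j ∧ ω.word j = w} ≤ ENNReal.ofReal K := by
    intro w hw
    obtain ⟨ω₀, hω₀, rfl⟩ := hfin.mem_toFinset.1 hw
    set S := (σ j).words.filter fun v => wordLength g (ω₀.word j ++ v) < d ∧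
      (wordMap g (ω₀.word j ++ v) '' Icc 0 1 ∩ Icc x (x + d)).Nonempty with hS
    have hsub : {ω : Code σ | ω ∈ stopping g σ x d j ∧ ω.word j = ω₀.word j} ⊆
        ⋃ v ∈ S, {ω' | (∀ i < j, ω' i = ω₀ i) ∧ (ω' j : List A) = v} := by
      rintro ω ⟨hω, he⟩
      refine mem_iUnion₂.2 ⟨ω j, Finset.mem_filter.2 ⟨(ω j).2, ?_⟩, eq_of_word_eq hσ he, rfl⟩
      have := hω.2
      rwa [word, he] at this
    refine (measure_mono hsub).trans ((measure_biUnion_finset_le _ _).trans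
      ((Finset.sum_le_sum fun v _ => measure_cylinder_le hσ ω₀ j v).trans ?_))
    have hw0 : 0 ≤ ω₀.weight j := Finset.prod_nonneg fun i _ => (hσ i).weight_nonneg _
    rw [← ENNReal.ofReal_sum_of_nonneg fun v _ => mul_nonneg hw0 ((hσ j).weight_nonneg _),
      ← Finset.mul_sum]
    apply ENNReal.ofReal_le_ofReal
    have hκ := lower_pos hσ ω₀ j
    have hsum := (hσ j).sum_le _ _ x d hκ hd (lowerLipschitz_word hg hσ ω₀ j) S
      (Finset.filter_subset _ _) fun v hv => (Finset.mem_filter.1 hv).2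
    calc _ ≤ ((∏ i ∈ Finset.range j, (σ i).ratio) * ω₀.lower j ^ s) *
          (C * (d / ω₀.lower j) ^ s * (σ j).ratio) := by
          refine mul_le_mul (weight_le hσ ω₀ j) hsum
            (Finset.sum_nonneg fun v _ => (hσ j).weight_nonneg _) ?_
          exact mul_nonneg (Finset.prod_nonneg fun i _ => (hσ i).ratio_nonneg)
            (Real.rpow_nonneg hκ.le _)
      _ = K := by
          rw [hK, Finset.prod_range_succ, Real.div_rpow hd.le hκ.le]
          have := (Real.rpow_pos_of_pos hκ s).ne'
          field_simp
  refine (measure_mono hcover).trans ((measure_biUnion_finset_le _ _).trans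
    ((Finset.sum_le_sum hpart).trans ?_))
  rw [Finset.sum_const, nsmul_eq_mul, ← ENNReal.ofReal_natCast,
    ← ENNReal.ofReal_mul (Nat.cast_nonneg _)]
  exact ENNReal.ofReal_le_ofReal (mul_le_mul_of_nonneg_right hcard hK0)

lemma exists_mem_image (hg : M.IsIFS g) (ω : Code σ) :
    ∃ x, ∀ j, x ∈ wordMap g (ω.word j) '' Icc 0 1 := by
  have h : ∀ w : List A, IsCompact (wordMap g w '' Icc (0:ℝ) 1) := fun w =>
    isCompact_Icc.image_of_continuousOn (hg.wordMap_continuousOn w)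
  obtain ⟨x, hx⟩ := IsCompact.nonempty_iInter_of_sequence_nonempty_isCompact_isClosed
    (fun j => wordMap g (ω.word j) '' Icc (0:ℝ) 1)
    (fun j => ExpandingMarkovMap.image_wordMap_append_subset hg _ _)
    (fun j => (nonempty_Icc.2 zero_le_one).image _) (h _) (fun j => (h _).isClosed)
  exact ⟨x, mem_iInter.1 hx⟩

lemma measurable_word [Countable A] [MeasurableSpace (List A)] [DiscreteMeasurableSpace (List A)]
    (j : ℕ) : Measurable fun ω : Code σ => ω.word j := by
  induction j with
  | zero => exact measurable_const
  | succ j ih =>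
    exact (Measurable.of_discrete (f := fun p : List A × List A => p.1 ++ p.2)).comp
      (ih.prodMk (measurable_subtype_coe.comp (measurable_pi_apply j)))

lemma tendsto_wordMap (hg : M.IsIFS g) (hσ : ∀ j, (σ j).Admissible g s C) (ω : Code σ) {x : ℝ}
    (hx : ∀ j, x ∈ wordMap g (ω.word j) '' Icc 0 1) :
    Tendsto (fun j => wordMap g (ω.word j) 0) atTop (𝓝 x) := by
  rw [Metric.tendsto_atTop]
  intro ε hε
  obtain ⟨n, hn⟩ := M.exists_wordLength_lt hg hε
  refine ⟨n, fun j hj => ?_⟩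
  rw [Real.dist_eq]
  exact (hg.dist_le_wordLength _ (mem_image_of_mem _ (left_mem_Icc.2 zero_le_one)) (hx j)).trans_lt
    (hn _ (hj.trans (le_length_word hσ ω j)))

lemma subset_iUnion_stopping (hg : M.IsIFS g) (hσ : ∀ j, (σ j).Admissible g s C)
    {π : Code σ → ℝ} (hπ : ∀ ω : Code σ, ∀ j, π ω ∈ wordMap g (ω.word j) '' Icc 0 1)
    (x : ℝ) {d : ℝ} (hd : 0 < d) (hd1 : d ≤ 1) :
    π ⁻¹' Icc x (x + d) ⊆ ⋃ j, stopping g σ x d j := by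
  classical
  intro ω hω
  obtain ⟨n, hn⟩ := M.exists_wordLength_lt hg hd
  have hex : ∃ j, wordLength g (ω.word j) < d := ⟨n, hn _ (le_length_word hσ ω n)⟩
  have h0 : Nat.find hex ≠ 0 := by
    intro h
    have := Nat.find_spec hex
    rw [h] at this
    simp [word, wordLength] at this
    linarith
  obtain ⟨j, hj⟩ := Nat.exists_eq_succ_of_ne_zero h0
  refine mem_iUnion.2 ⟨j, not_lt.1 (Nat.find_min hex (by omega)), ?_, π ω, hπ ω _, hω⟩
  have := Nat.find_spec hex
  rwa [hj] at this

/-- **Mass distribution.** A set containing every point coded by a sequence of admissible steps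
has positive Hausdorff measure, provided that the products of the ratios decay
geometrically. -/
theorem hausdorffMeasure_pos (hg : M.IsIFS g) (hs : 0 < s) (hC : 0 ≤ C)
    (hσ : ∀ j, (σ j).Admissible g s C) {q : ℝ} (hq0 : 0 ≤ q) (hq1 : q < 1)
    (hq : ∀ j, ∏ i ∈ Finset.range j, (σ i).ratio ≤ q ^ j) {D : Set ℝ}
    (hD : ∀ (ω : Code σ) (x : ℝ), (∀ j, x ∈ wordMap g (ω.word j) '' Icc 0 1) → x ∈ D) :
    0 < μH[s] D := by
  have := M.countable
  let _ : MeasurableSpace (List A) := ⊤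
  have : DiscreteMeasurableSpace (List A) := ⟨fun _ => trivial⟩
  have hprob := fun j => isProbabilityMeasure_stepMeasure hσ j
  set P := Measure.infinitePi (stepMeasure σ) with hP
  choose π hπ using fun ω : Code σ => exists_mem_image hg ω
  have hmeas : Measurable π := by
    refine measurable_of_tendsto_metrizable
      (f := fun j (ω : Code σ) => wordMap g (ω.word j) 0) (fun j => ?_)
      (tendsto_pi_nhds.2 fun ω => tendsto_wordMap hg hσ ω (hπ ω))
    exact (Measurable.of_discrete (f := fun w : List A => wordMap g w 0)).comp (measurable_word j)
  have hsum : Summable fun j : ℕ => q ^ (j + 1) := by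
    simpa [pow_succ] using (summable_geometric_of_lt_one hq0 hq1).mul_right q
  set K := 3 * C * (∑' j : ℕ, q ^ (j + 1)) + 1 with hK
  have hKpos : 0 < K := by
    have : 0 ≤ ∑' j : ℕ, q ^ (j + 1) := tsum_nonneg fun j => pow_nonneg hq0 _
    positivity
  have hball : ∀ x d : ℝ, 0 < d → d ≤ 1 →
      P (π ⁻¹' Icc x (x + d)) ≤ ENNReal.ofReal (K * d ^ s) := by
    intro x d hd hd1
    have hds := Real.rpow_nonneg hd.le s
    calc _ ≤ P (⋃ j, stopping g σ x d j) :=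
          measure_mono (subset_iUnion_stopping hg hσ hπ x hd hd1)
      _ ≤ ∑' j, P (stopping g σ x d j) := measure_iUnion_le _
      _ ≤ ∑' j : ℕ, ENNReal.ofReal (3 * C * d ^ s * q ^ (j + 1)) := by
          refine ENNReal.tsum_le_tsum fun j => (measure_stopping_le hg hC hσ x hd j).trans ?_
          apply ENNReal.ofReal_le_ofReal
          have := mul_le_mul_of_nonneg_left (hq (j + 1)) (by positivity : 0 ≤ 3 * C * d ^ s)
          linarith
      _ = ENNReal.ofReal (3 * C * d ^ s * ∑' j : ℕ, q ^ (j + 1)) := by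
          rw [← ENNReal.ofReal_tsum_of_nonneg (fun j => by positivity) (hsum.mul_left _),
            tsum_mul_left]
      _ ≤ _ := by
          apply ENNReal.ofReal_le_ofReal
          rw [hK]
          nlinarith
  set ν := (ENNReal.ofReal K)⁻¹ • P.map π with hν
  have hK0 : ENNReal.ofReal K ≠ 0 := by simpa using hKpos
  have hle : ν ≤ μH[s] := by
    refine Measure.le_hausdorffMeasure s ν (ENNReal.ofReal (1 / 2)) (by simp) fun U hU => ?_
    rw [hν, Measure.smul_apply, smul_eq_mul]
    rcases U.eq_empty_or_nonempty with rfl | ⟨u, hu⟩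
    · simp
    have htop : Metric.ediam U ≠ ⊤ := (hU.trans_lt ENNReal.ofReal_lt_top).ne
    have hbdd : Bornology.IsBounded U := Metric.isBounded_iff_ediam_ne_top.2 htop
    set δ := Metric.diam U with hδ
    have hδ0 : 0 ≤ δ := Metric.diam_nonneg
    have hed : Metric.ediam U = ENNReal.ofReal δ := (ENNReal.ofReal_toReal htop).symm
    have hδ1 : δ ≤ 1 / 2 := by
      rw [hed] at hU
      exact (ENNReal.ofReal_le_ofReal_iff (by norm_num)).1 hU
    have hsubU : U ⊆ Icc (sInf U) (sInf U + δ) := by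
      intro z hz
      refine ⟨csInf_le hbdd.bddBelow hz, ?_⟩
      have : z - δ ≤ sInf U := by
        refine le_csInf ⟨u, hu⟩ fun v hv => ?_
        have := Metric.dist_le_diam_of_mem hbdd hz hv
        rw [Real.dist_eq] at this
        linarith [le_abs_self (z - v)]
      linarith
    have hmU : ∀ ε : ℝ, 0 < ε → ε ≤ 1 / 2 →
        P.map π U ≤ ENNReal.ofReal (K * (δ + ε) ^ s) := by
      intro ε hε hε1
      refine le_trans ?_ (hball (sInf U) (δ + ε) (by linarith) (by linarith))
      rw [← Measure.map_apply hmeas measurableSet_Icc]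
      exact measure_mono (hsubU.trans (Icc_subset_Icc_right (by linarith)))
    have hlim : P.map π U ≤ ENNReal.ofReal (K * δ ^ s) := by
      have ht : Tendsto (fun ε : ℝ => ENNReal.ofReal (K * (δ + ε) ^ s)) (𝓝[>] 0)
          (𝓝 (ENNReal.ofReal (K * δ ^ s))) := by
        have hc : ContinuousAt (fun ε : ℝ => ENNReal.ofReal (K * (δ + ε) ^ s)) 0 := by
          refine ENNReal.continuous_ofReal.continuousAt.comp ?_
          exact continuousAt_const.mul
            ((continuousAt_const.add continuousAt_id).rpow_const (Or.inr hs.le))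
        simpa using hc.tendsto.mono_left (nhdsWithin_le_nhds (s := Ioi 0))
      refine ge_of_tendsto ht ?_
      filter_upwards [Ioc_mem_nhdsGT (show (0:ℝ) < 1 / 2 by norm_num)] with ε hε
      exact hmU ε hε.1 hε.2
    rw [hed, ENNReal.ofReal_rpow_of_nonneg hδ0 hs.le]
    calc _ ≤ (ENNReal.ofReal K)⁻¹ * ENNReal.ofReal (K * δ ^ s) := by gcongr
      _ = _ := by
        rw [ENNReal.ofReal_mul hKpos.le, ← mul_assoc,
          ENNReal.inv_mul_cancel hK0 ENNReal.ofReal_ne_top, one_mul]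
  refine lt_of_lt_of_le ?_ (hle D)
  have h1 : 1 ≤ P.map π D := by
    refine le_trans ?_ (Measure.le_map_apply hmeas.aemeasurable D)
    rw [show π ⁻¹' D = univ from eq_univ_of_forall fun ω => hD ω _ (hπ ω), measure_univ]
  rw [hν, Measure.smul_apply, smul_eq_mul]
  exact ENNReal.mul_pos (by simp) (zero_lt_one.trans_le h1).ne'

end Code

namespace ExpandingMarkovMap

variable {A : Type} {M : ExpandingMarkovMap A} {g : A → ℝ → ℝ} {φ : ℝ → ℝ}

lemma iterate_mem_repeller {x : ℝ} (hx : x ∈ M.repeller) (n : ℕ) : M.T^[n] x ∈ M.repeller := by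
  intro m
  rw [← Function.iterate_add_apply]
  exact hx _

lemma birkhoff_add (φ : ℝ → ℝ) (m n : ℕ) (x : ℝ) :
    M.birkhoff φ (m + n) x = M.birkhoff φ m x + M.birkhoff φ n (M.T^[m] x) := by
  rw [birkhoff, birkhoff, birkhoff, Finset.sum_range_add]
  simp only [← Function.iterate_add_apply, add_comm m]

lemma abs_birkhoff_sub_le {B : ℝ} (hB : B ∈ upperBounds (M.varSet φ 1)) (w : List A) {x z : ℝ}
    (hx : x ∈ M.listCylinder w ∩ M.repeller) (hz : z ∈ M.listCylinder w ∩ M.repeller) :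
    |M.birkhoff φ w.length x - M.birkhoff φ w.length z| ≤ w.length * B := by
  rw [birkhoff, birkhoff, ← Finset.sum_sub_distrib]
  refine (Finset.abs_sum_le_sum_abs _ _).trans ?_
  calc _ ≤ ∑ _l ∈ Finset.range w.length, B := by
        refine Finset.sum_le_sum fun l hl => hB ?_
        have hl := Finset.mem_range.1 hl
        refine ⟨fun _ => w.get ⟨l, hl⟩, _, ⟨?_, iterate_mem_repeller hx.2 l⟩, _,
          ⟨?_, iterate_mem_repeller hz.2 l⟩, rfl⟩
        · intro ν
          simpa using (M.mem_listCylinder_iff w x).1 hx.1 ⟨l, hl⟩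
        · intro ν
          simpa using (M.mem_listCylinder_iff w z).1 hz.1 ⟨l, hl⟩
    _ = _ := by simp

lemma Tempered.exists_birkhoff_le (hφ : M.Tempered φ) (w : List A) :
    ∃ F, 0 ≤ F ∧ ∀ x ∈ M.listCylinder w ∩ M.repeller, M.birkhoff φ w.length x ≤ F := by
  obtain ⟨B, hB⟩ := hφ.1
  by_cases h : (M.listCylinder w ∩ M.repeller).Nonempty
  · obtain ⟨z, hz⟩ := h
    refine ⟨max 0 (M.birkhoff φ w.length z + w.length * B), le_max_left _ _, fun x hx =>
      le_max_of_le_right ?_⟩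
    linarith [le_of_abs_le (abs_birkhoff_sub_le hB w hx hz)]
  · exact ⟨0, le_rfl, fun x hx => (h ⟨x, hx⟩).elim⟩

lemma Tempered.birkhoff_le_add_var (hφ : M.Tempered φ) (w : List A) {x z : ℝ}
    (hx : x ∈ M.listCylinder w ∩ M.repeller) (hz : z ∈ M.listCylinder w ∩ M.repeller) :
    M.birkhoff φ w.length x ≤
      M.birkhoff φ w.length z + M.var (M.birkhoff φ w.length) w.length := by
  obtain ⟨B, hB⟩ := hφ.1
  have hcyl : M.listCylinder w = M.cylinder w.get := by
    rw [← M.listCylinder_ofFn, List.ofFn_get]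
  have hle := le_csSup (s := M.varSet (M.birkhoff φ w.length) w.length)
    (a := |M.birkhoff φ w.length x - M.birkhoff φ w.length z|)
    ⟨w.length * B, by
      rintro _ ⟨ω, a, ha, b, hb, rfl⟩
      rw [← M.listCylinder_ofFn] at ha hb
      simpa using abs_birkhoff_sub_le hB (List.ofFn ω) (x := a) (z := b) (by simpa using ha)
        (by simpa using hb)⟩
    ⟨w.get, x, hcyl ▸ hx, z, hcyl ▸ hz, rfl⟩
  rw [var]
  linarith [le_abs_self (M.birkhoff φ w.length x - M.birkhoff φ w.length z)]

/-- A continuous self-map of `[0, 1]` has a fixed point. -/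
lemma exists_fixedPoint_wordMap (hg : M.IsIFS g) (w : List A) :
    ∃ t ∈ Icc (0:ℝ) 1, wordMap g w t = t := by
  obtain ⟨t, ht, h⟩ := exists_mem_Icc_isFixedPt_of_mapsTo (hg.wordMap_continuousOn w) zero_le_one
    (hg.wordMap_mapsTo w)
  exact ⟨t, ht, h⟩

lemma mem_repeller_of_wordMap_eq (hg : M.IsIFS g) {w : List A} (hw : w ≠ []) {t : ℝ}
    (ht : t ∈ Ioo (0:ℝ) 1) (h : wordMap g w t = t) : t ∈ M.repeller := by
  have hcyl := (hg.wordMap_Ioo w ht).2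
  rw [h] at hcyl
  have hpos : 0 < w.length := List.length_pos_of_ne_nil hw
  intro n
  induction n using Nat.strong_induction_on with
  | _ n ih =>
    rcases lt_or_ge n w.length with hn | hn
    · exact mem_iUnion.2 ⟨_, (M.mem_listCylinder_iff w t).1 hcyl.1 ⟨n, hn⟩⟩
    · obtain ⟨k, rfl⟩ := Nat.exists_eq_add_of_le' hn
      rw [Function.iterate_add_apply, hcyl.2.1]
      exact ih k (by omega)

/-- The ends of distinct inverse branches: `0` (or `1`) lies in the closure of at most one of the
intervals `V i`. -/
lemma not_mem_closure_V {i j : A} (hij : i ≠ j) {t : ℝ} (ht : t = 0 ∨ t = 1)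
    (hi : t ∈ closure (M.V i)) (hj : t ∈ closure (M.V j)) : False := by
  obtain ⟨a, ha⟩ := M.V_interior_nonempty i
  obtain ⟨b, hb⟩ := M.V_interior_nonempty j
  have ha01 := M.interior_V_subset i ha
  have hb01 := M.interior_V_subset j hb
  have ha := interior_subset ha
  have hb := interior_subset hb
  have hdisj := Set.disjoint_left.1 (M.V_disjoint hij)
  rcases ht with rfl | rfl
  · obtain ⟨u, hu, hu'⟩ := Metric.mem_closure_iff.1 hi b hb01.1
    obtain ⟨v, hv, hv'⟩ := Metric.mem_closure_iff.1 hj a ha01.1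
    rw [Real.dist_eq, zero_sub, abs_neg] at hu' hv'
    have hu' := (le_abs_self u).trans_lt hu'
    have hv' := (le_abs_self v).trans_lt hv'
    rcases le_total a b with h | h
    · exact hdisj ha ((M.V_ordConnected j).out hv hb ⟨hv'.le, h⟩)
    · exact hdisj ((M.V_ordConnected i).out hu ha ⟨hu'.le, h⟩) hb
  · obtain ⟨u, hu, hu'⟩ := Metric.mem_closure_iff.1 hi (1 - b) (by linarith [hb01.2])
    obtain ⟨v, hv, hv'⟩ := Metric.mem_closure_iff.1 hj (1 - a) (by linarith [ha01.2])
    rw [Real.dist_eq] at hu' hv'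
    have hu' := (le_abs_self _).trans_lt hu'
    have hv' := (le_abs_self _).trans_lt hv'
    rcases le_total a b with h | h
    · exact hdisj ((M.V_ordConnected i).out ha hu ⟨h, by linarith⟩) hb
    · exact hdisj ha ((M.V_ordConnected j).out hb hv ⟨h, by linarith⟩)

lemma exists_mem_repeller (hg : M.IsIFS g) : ∃ t ∈ Ioo (0:ℝ) 1, t ∈ M.repeller := by
  by_contra! hno
  have hend : ∀ w : List A, w ≠ [] → ∃ t, (t = 0 ∨ t = 1) ∧ wordMap g w t = t := by
    intro w hw
    obtain ⟨t, ht, h⟩ := exists_fixedPoint_wordMap hg w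
    refine ⟨t, ?_, h⟩
    by_contra! hne
    exact hno t ⟨lt_of_le_of_ne ht.1 hne.1.symm, lt_of_le_of_ne ht.2 hne.2⟩
      (mem_repeller_of_wordMap_eq hg hw
        ⟨lt_of_le_of_ne ht.1 hne.1.symm, lt_of_le_of_ne ht.2 hne.2⟩ h)
  have hmem : ∀ t : ℝ, (t = 0 ∨ t = 1) → t ∈ Icc (0:ℝ) 1 := by
    rintro t (rfl | rfl) <;> simp
  have hcl : ∀ (i : A) (w : List A) (t : ℝ), (t = 0 ∨ t = 1) → wordMap g (i :: w) t = t →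
      t ∈ closure (M.V i) := by
    intro i w t ht h
    rw [← h]
    exact (hg i).2.1 (hg.wordMap_mapsTo w (hmem t ht))
  obtain ⟨i, j, hij⟩ := M.nontriv
  obtain ⟨a, ha, hai⟩ := hend [i] (by simp)
  obtain ⟨b, hb, hbj⟩ := hend [j] (by simp)
  obtain ⟨c, hc, hcij⟩ := hend [i, j] (by simp)
  have hab : a ≠ b := by
    rintro rfl
    exact not_mem_closure_V hij ha (hcl i [] a ha hai) (hcl j [] a ha hbj)
  have hcb : c ≠ b := by
    rintro rfl
    exact not_mem_closure_V hij hb (hcl i _ c hb hcij) (hcl j _ c hb hbj)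
  have hca : c = a := by
    rcases ha with rfl | rfl <;> rcases hb with rfl | rfl <;> rcases hc with rfl | rfl <;>
      first | rfl | exact absurd rfl hab | exact absurd rfl hcb
  subst hca
  have h1 : wordMap g [i] (wordMap g [j] c) = wordMap g [i] c := by
    rw [hai]
    exact hcij
  have h2 := hg.wordMap_injOn [i] (hg.wordMap_mapsTo [j] (hmem c ha)) (hmem c ha) h1
  exact not_mem_closure_V hij ha (hcl i [] c ha hai) (hcl j [] c ha h2)

lemma wordMap_mem_repeller (hg : M.IsIFS g) (w : List A) {t : ℝ} (ht : t ∈ Ioo (0:ℝ) 1)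
    (htr : t ∈ M.repeller) : wordMap g w t ∈ M.repeller := by
  have h := (hg.wordMap_Ioo w ht).2
  intro n
  rcases lt_or_ge n w.length with hn | hn
  · exact mem_iUnion.2 ⟨_, (M.mem_listCylinder_iff w _).1 h.1 ⟨n, hn⟩⟩
  · obtain ⟨k, rfl⟩ := Nat.exists_eq_add_of_le' hn
    rw [Function.iterate_add_apply, h.2.1]
    exact htr k

lemma listCylinder_inter_repeller_nonempty (hg : M.IsIFS g) (w : List A) :
    (M.listCylinder w ∩ M.repeller).Nonempty := by
  obtain ⟨t, ht, htr⟩ := exists_mem_repeller hg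
  exact ⟨_, (hg.wordMap_Ioo w ht).2.1, wordMap_mem_repeller hg w ht htr⟩

end ExpandingMarkovMap

namespace ExpandingMarkovMap

variable {A : Type} {M : ExpandingMarkovMap A} {g : A → ℝ → ℝ} {φ : ℝ → ℝ} {s : ℝ}

/-- A finite family of words of common length `n` with a lower Lipschitz constant `a w` and an
upper bound `k w` of the Birkhoff sums of `φ` for each of them. -/
structure IsBlockSystem (M : ExpandingMarkovMap A) (g : A → ℝ → ℝ) (φ : ℝ → ℝ) (n : ℕ)
    (G : Finset (List A)) (a : List A → ℝ) (k : List A → ℕ) : Prop where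
  length_eq : ∀ w ∈ G, w.length = n
  pos : ∀ w, 0 < a w
  one_le : ∀ w, 1 ≤ k w
  lowerLipschitz : ∀ w ∈ G, LowerLipschitz g w (a w)
  birkhoff_le : ∀ w ∈ G, ∀ x ∈ M.listCylinder w ∩ M.repeller, M.birkhoff φ n x ≤ k w

lemma IsBlockSystem.pow (hg : M.IsIFS g) {n K : ℕ} {G : Finset (List A)} {a : List A → ℝ}
    {k : List A → ℕ} (h : IsBlockSystem M g φ n G a k) (hK : ∀ w ∈ G, k w ≤ K) (N : ℕ) :
    ∃ G' a' k', IsBlockSystem M g φ ((N + 1) * n) G' a' k' ∧ (∀ w ∈ G', k' w ≤ (N + 1) * K) ∧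
      ∑ w ∈ G', a' w ^ s * Real.exp (-(s * k' w)) =
        (∑ w ∈ G, a w ^ s * Real.exp (-(s * k w))) ^ (N + 1) := by
  classical
  induction N with
  | zero => exact ⟨G, a, k, by simpa using h, by simpa using hK, by simp⟩
  | succ N ih =>
    obtain ⟨G', a', k', h', hK', hsum⟩ := ih
    set m := (N + 1) * n with hm
    have htake : ∀ w ∈ G', ∀ v : List A, (w ++ v).take m = w ∧ (w ++ v).drop m = v := by
      intro w hw v
      rw [← h'.length_eq w hw]
      simp
    refine ⟨Finset.image₂ (· ++ ·) G' G, fun u => a' (u.take m) * a (u.drop m),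
      fun u => k' (u.take m) + k (u.drop m), ⟨?_, ?_, ?_, ?_, ?_⟩, ?_, ?_⟩
    · intro u hu
      obtain ⟨w, hw, v, hv, rfl⟩ := Finset.mem_image₂.1 hu
      rw [List.length_append, h'.length_eq w hw, h.length_eq v hv]
      ring
    · exact fun u => mul_pos (h'.pos _) (h.pos _)
    · exact fun u => le_add_right (h'.one_le _)
    · intro u hu
      obtain ⟨w, hw, v, hv, rfl⟩ := Finset.mem_image₂.1 hu
      rw [(htake w hw v).1, (htake w hw v).2]
      exact lowerLipschitz_append hg (h'.pos _).le (h'.lowerLipschitz w hw) (h.lowerLipschitz v hv)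
    · intro u hu x hx
      obtain ⟨w, hw, v, hv, rfl⟩ := Finset.mem_image₂.1 hu
      rw [(htake w hw v).1, (htake w hw v).2, add_mul (N + 1) 1 n, one_mul, birkhoff_add]
      rw [listCylinder_append, h'.length_eq w hw] at hx
      push_cast
      exact add_le_add (h'.birkhoff_le w hw x ⟨hx.1.1, hx.2⟩)
        (h.birkhoff_le v hv _ ⟨hx.1.2, iterate_mem_repeller hx.2 _⟩)
    · intro u hu
      obtain ⟨w, hw, v, hv, rfl⟩ := Finset.mem_image₂.1 hu
      beta_reduce
      rw [(htake w hw v).1, (htake w hw v).2, add_mul (N + 1) 1 K, one_mul]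
      exact add_le_add (hK' w hw) (hK v hv)
    · rw [pow_succ, ← hsum, Finset.sum_mul_sum, ← Finset.sum_product', Finset.image₂,
        Finset.sum_image]
      · refine Finset.sum_congr rfl fun p hp => ?_
        obtain ⟨hp1, hp2⟩ := Finset.mem_product.1 hp
        simp only [Function.uncurry, (htake p.1 hp1 p.2).1, (htake p.1 hp1 p.2).2]
        rw [Real.mul_rpow (h'.pos _).le (h.pos _).le, Nat.cast_add, mul_add, neg_add, Real.exp_add]
        ring
      · rintro ⟨w, v⟩ hp ⟨w', v'⟩ hp' he
        have hp := (Finset.mem_product.1 hp).1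
        have hp' := (Finset.mem_product.1 hp').1
        simp only [Function.uncurry] at he
        have h1 := htake w hp v
        rw [he, (htake w' hp' v').1, (htake w' hp' v').2] at h1
        rw [h1.1, h1.2]

lemma IsBlockSystem.exists_uniform (hg : M.IsIFS g) {n : ℕ} (hn : 1 ≤ n) {G : Finset (List A)}
    {a : List A → ℝ} {k : List A → ℕ} (h : IsBlockSystem M g φ n G a k)
    (h1 : 1 < ∑ w ∈ G, a w ^ s * Real.exp (-(s * k w))) :
    ∃ m G' a' k', 1 ≤ m ∧ 1 ≤ k' ∧ IsBlockSystem M g φ m G' a' (fun _ => k') ∧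
      1 < ∑ w ∈ G', a' w ^ s * Real.exp (-(s * k')) := by
  classical
  set Z := ∑ w ∈ G, a w ^ s * Real.exp (-(s * k w)) with hZ
  obtain ⟨K, hK⟩ : ∃ K, ∀ w ∈ G, k w ≤ K := ⟨G.sup k, fun w hw => Finset.le_sup hw⟩
  obtain ⟨N, hN⟩ : ∃ N : ℕ, ((N + 1) * K + 1 : ℝ) < Z ^ (N + 1) := by
    have h0 := tendsto_pow_const_div_const_pow_of_one_lt 1 h1
    have hg0 : Tendsto (fun N : ℕ => 1 / Z ^ N) atTop (𝓝 0) := by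
      simpa using tendsto_pow_const_div_const_pow_of_one_lt 0 h1
    have := ((h0.const_mul (K : ℝ)).add hg0)
    rw [mul_zero, zero_add] at this
    obtain ⟨N, hN⟩ := (((tendsto_add_atTop_iff_nat 1).2 this).eventually_lt_const
      zero_lt_one).exists
    refine ⟨N, ?_⟩
    have hp : 0 < Z ^ (N + 1) := pow_pos (by linarith) _
    rw [pow_one, mul_div_assoc', ← add_div, div_lt_one hp] at hN
    push_cast at hN
    linarith
  obtain ⟨G', a', k', h', hK', hsum⟩ := h.pow (s := s) hg hK N
  have hmaps : ∀ w ∈ G', k' w ∈ Finset.range ((N + 1) * K + 1) := fun w hw =>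
    Finset.mem_range.2 (Nat.lt_succ_of_le (hK' w hw))
  rw [← Finset.sum_fiberwise_of_maps_to hmaps] at hsum
  obtain ⟨j, -, hj⟩ : ∃ j ∈ Finset.range ((N + 1) * K + 1),
      1 < ∑ w ∈ G' with k' w = j, a' w ^ s * Real.exp (-(s * k' w)) := by
    by_contra! hle
    have := Finset.sum_le_sum hle
    rw [hsum] at this
    simp only [Finset.sum_const, Finset.card_range, nsmul_eq_mul, mul_one] at this
    push_cast at this
    linarith
  have hmem : ∀ w ∈ G'.filter (fun w => k' w = j), w ∈ G' ∧ k' w = j := fun w hw =>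
    Finset.mem_filter.1 hw
  obtain ⟨w, hw⟩ : (G'.filter fun w => k' w = j).Nonempty := by
    refine Finset.nonempty_iff_ne_empty.2 fun he => ?_
    rw [he, Finset.sum_empty] at hj
    linarith
  refine ⟨(N + 1) * n, G'.filter fun w => k' w = j, a', j, ?_, ?_, ⟨?_, h'.pos, ?_, ?_, ?_⟩, ?_⟩
  · exact Nat.mul_pos N.succ_pos hn
  · exact (hmem w hw).2 ▸ h'.one_le w
  · exact fun w hw => h'.length_eq w (hmem w hw).1
  · exact fun _ => (hmem w hw).2 ▸ h'.one_le w
  · exact fun w hw => h'.lowerLipschitz w (hmem w hw).1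
  · intro w hw x hx
    have := h'.birkhoff_le w (hmem w hw).1 x hx
    rwa [(hmem w hw).2] at this
  · refine hj.trans_eq (Finset.sum_congr rfl fun w hw => ?_)
    rw [(hmem w hw).2]

lemma frequently_exp_lt_sum {f : ℝ → ℝ} (hP : 0 < M.pressure f) :
    ∃ δ > 0, ∃ᶠ n : ℕ in atTop, ∃ F : Finset (Fin n → A),
      Real.exp (n * δ) < ∑ ω ∈ F, Real.exp (M.birkhoffSup f ω) := by
  obtain ⟨δ, hδ0, hδ⟩ := EReal.lt_iff_exists_real_btwn.1 hP
  refine ⟨δ, by exact_mod_cast hδ0, ?_⟩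
  refine ((frequently_lt_of_lt_limsup (by isBoundedDefault) hδ).and_eventually
    (eventually_ge_atTop 1)).mono ?_
  rintro n ⟨h, hn⟩
  have hn0 : (0:ℝ) < n := by exact_mod_cast hn
  have hlog : ((n * δ : ℝ) : EReal) <
      ENNReal.log (∑' ω : Fin n → A, ENNReal.ofReal (Real.exp (M.birkhoffSup f ω))) := by
    generalize ENNReal.log (∑' ω : Fin n → A,
      ENNReal.ofReal (Real.exp (M.birkhoffSup f ω))) = L at h
    induction L using EReal.rec with
    | bot =>
      rw [EReal.coe_mul_bot_of_pos (by positivity)] at h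
      exact absurd h not_lt_bot
    | coe x =>
      rw [← EReal.coe_mul, EReal.coe_lt_coe_iff] at h
      rw [EReal.coe_lt_coe_iff]
      rw [one_div, inv_mul_eq_div, lt_div_iff₀ hn0] at h
      linarith
    | top => exact EReal.coe_lt_top _
  rw [← Real.log_exp (n * δ), ← ENNReal.log_ofReal_of_pos (Real.exp_pos _),
    ENNReal.log_lt_log_iff, ENNReal.tsum_eq_iSup_sum, lt_iSup_iff] at hlog
  obtain ⟨F, hF⟩ := hlog
  rw [← ENNReal.ofReal_sum_of_nonneg fun ω _ => (Real.exp_pos _).le] at hF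
  exact ⟨F, (ENNReal.ofReal_lt_ofReal_iff_of_nonneg (Real.exp_pos _).le).1 hF⟩

lemma birkhoff_psi_add {w : List A} {x : ℝ} (hx : x ∈ M.listCylinder w) :
    M.birkhoff (fun x => -s * (M.psi x + φ x)) w.length x =
      -s * (Real.log (M.derivIter w.length x) + M.birkhoff φ w.length x) := by
  rw [derivIter, Real.log_prod, birkhoff, birkhoff, ← Finset.sum_add_distrib, Finset.mul_sum]
  · rfl
  · intro l hl
    exact abs_ne_zero.2 (M.T'_ne_zero
      ((M.mem_listCylinder_iff w x).1 hx ⟨l, Finset.mem_range.1 hl⟩))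

lemma var_nonneg (f : ℝ → ℝ) (n : ℕ) : 0 ≤ M.var f n := by
  apply Real.sSup_nonneg
  rintro _ ⟨ω, x, -, z, -, rfl⟩
  exact abs_nonneg _

lemma birkhoff_nonneg (hφ0 : ∀ x ∈ M.repeller, 0 ≤ φ x) (n : ℕ) {x : ℝ} (hx : x ∈ M.repeller) :
    0 ≤ M.birkhoff φ n x :=
  Finset.sum_nonneg fun l _ => hφ0 _ (iterate_mem_repeller hx l)

lemma exists_isBlockSystem (hg : M.IsIFS g) (hφ0 : ∀ x ∈ M.repeller, 0 ≤ φ x)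
    (hφ : M.Tempered φ) (hs : 0 < s)
    (hP : 0 < M.pressure (fun x => -s * (M.psi x + φ x))) :
    ∃ n G a k, 1 ≤ n ∧ IsBlockSystem M g φ n G a k ∧
      1 < ∑ w ∈ G, a w ^ s * Real.exp (-(s * k w)) := by
  classical
  set f : ℝ → ℝ := fun x => -s * (M.psi x + φ x) with hf
  obtain ⟨δ, hδ, hfreq⟩ := frequently_exp_lt_sum hP
  obtain ⟨ρ, -, hρ0, hρ⟩ := M.exists_distortion
  set v : ℕ → ℝ := fun n => M.var (M.birkhoff φ n) n with hv
  have hev : ∀ᶠ n : ℕ in atTop, (1 + 2 * s) / n + s * ρ n + s * (v n / n) < δ := by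
    have := ((tendsto_const_div_atTop_nhds_zero_nat (1 + 2 * s)).add (hρ0.const_mul s)).add
      (hφ.2.const_mul s)
    simp only [mul_zero, add_zero] at this
    exact this.eventually_lt_const hδ
  obtain ⟨n, ⟨⟨F, hF⟩, hn⟩, hn1⟩ :=
    ((hfreq.and_eventually hev).and_eventually (eventually_ge_atTop 1)).exists
  have hn0 : (0:ℝ) < n := by exact_mod_cast hn1
  have hx : ∀ w : List A, ∃ x ∈ M.listCylinder w ∩ M.repeller,
      sSup {u | ∃ x ∈ M.listCylinder w ∩ M.repeller, u = M.birkhoff f w.length x} - 1 <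
        M.birkhoff f w.length x := by
    intro w
    obtain ⟨z, hz⟩ := listCylinder_inter_repeller_nonempty hg w
    obtain ⟨_, ⟨x, hx, rfl⟩, h⟩ := exists_lt_of_lt_csSup
      (s := {u | ∃ x ∈ M.listCylinder w ∩ M.repeller, u = M.birkhoff f w.length x})
      ⟨_, z, hz, rfl⟩ (sub_one_lt _)
    exact ⟨x, hx, h⟩
  choose X hX hsup using hx
  have hD : ∀ w, 0 < M.derivIter w.length (X w) := fun w => M.derivIter_pos (hX w).1
  have hS : ∀ w : List A, 0 ≤ M.birkhoff φ w.length (X w) + v w.length := fun w =>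
    add_nonneg (birkhoff_nonneg hφ0 _ (hX w).2) (var_nonneg _ _)
  have hlen : ∀ w ∈ F.map ⟨_, List.ofFn_injective⟩, w.length = n := by
    intro w hw
    obtain ⟨ω, -, rfl⟩ := Finset.mem_map.1 hw
    simp
  set a : List A → ℝ := fun w =>
    Real.exp (-(w.length * ρ w.length)) / M.derivIter w.length (X w) with ha
  set k : List A → ℕ := fun w => ⌈M.birkhoff φ w.length (X w) + v w.length⌉₊ + 1 with hk
  refine ⟨n, F.map ⟨_, List.ofFn_injective⟩, a, k, hn1, ⟨hlen, ?_, ?_, ?_, ?_⟩, ?_⟩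
  · exact fun w => div_pos (Real.exp_pos _) (hD w)
  · exact fun w => Nat.le_add_left _ _
  · intro w _
    refine lowerLipschitz_of_derivIter_le hg fun x hx => ?_
    rw [div_mul_eq_mul_div, div_le_one (hD w)]
    have := mul_le_mul_of_nonneg_left (hρ w x (X w) hx (hX w).1)
      (Real.exp_pos (-(w.length * ρ w.length))).le
    rwa [← mul_assoc, ← Real.exp_add, neg_add_cancel, Real.exp_zero, one_mul] at this
  · intro w hw x hx
    have h1 := hφ.birkhoff_le_add_var w hx (hX w)
    have h2 := Nat.le_ceil (M.birkhoff φ w.length (X w) + v w.length)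
    rw [← hlen w hw]
    push_cast [hk]
    linarith
  · have hterm : ∀ ω ∈ F, Real.exp (M.birkhoffSup f ω) * Real.exp (-(n * δ)) ≤
        a (List.ofFn ω) ^ s * Real.exp (-(s * k (List.ofFn ω))) := by
      intro ω _
      have h1 := hsup (List.ofFn ω)
      have h2 := Nat.ceil_lt_add_one (hS (List.ofFn ω))
      rw [hf, birkhoff_psi_add (hX (List.ofFn ω)).1] at h1
      have hD' := hD (List.ofFn ω)
      have hsupeq : sSup {u | ∃ x ∈ M.listCylinder (List.ofFn ω) ∩ M.repeller,
          u = M.birkhoff f (List.ofFn ω).length x} = M.birkhoffSup f ω := by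
        rw [birkhoffSup, listCylinder_ofFn, List.length_ofFn]
      rw [hsupeq] at h1
      simp only [ha]
      rw [Real.div_rpow (Real.exp_pos _).le hD'.le, ← Real.exp_mul,
        Real.rpow_def_of_pos hD', ← Real.exp_sub, ← Real.exp_add, ← Real.exp_add,
        Real.exp_le_exp]
      simp only [hk]
      push_cast
      simp only [List.length_ofFn] at h1 h2 hD' ⊢
      have h3 : (1 + 2 * s) + s * (n * ρ n) + s * v n ≤ n * δ := by
        have := mul_lt_mul_of_pos_left hn hn0
        have he : (n:ℝ) * ((1 + 2 * s) / n + s * ρ n + s * (v n / n)) =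
            (1 + 2 * s) + s * (n * ρ n) + s * v n := by
          field_simp
        linarith
      have h4 := mul_lt_mul_of_pos_left h2 hs
      nlinarith
    rw [Finset.sum_map]
    calc (1:ℝ) < (∑ ω ∈ F, Real.exp (M.birkhoffSup f ω)) * Real.exp (-(n * δ)) := by
          have := mul_lt_mul_of_pos_right hF (Real.exp_pos (-(n * δ)))
          rwa [← Real.exp_add, add_neg_cancel, Real.exp_zero] at this
      _ ≤ _ := by
          rw [Finset.sum_mul]
          exact Finset.sum_le_sum hterm

lemma IsBlockSystem.lt_one (hg : M.IsIFS g) (hs : 0 < s) {n k : ℕ} {G : Finset (List A)}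
    {a : List A → ℝ} (h : IsBlockSystem M g φ n G a fun _ => k)
    (h1 : 1 < ∑ w ∈ G, a w ^ s * Real.exp (-(s * k))) : s < 1 := by
  by_contra! hs1
  have hle : ∀ w ∈ G, a w ≤ wordLength g w := fun w hw => le_wordLength (h.lowerLipschitz w hw)
  have hsum := hg.sum_wordLength_le_one G h.length_eq
  have : ∑ w ∈ G, a w ^ s * Real.exp (-(s * k)) ≤ ∑ w ∈ G, wordLength g w := by
    refine Finset.sum_le_sum fun w hw => ?_
    have hw1 : a w ≤ 1 := (hle w hw).trans ((Finset.single_le_sum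
      (fun v _ => (hg.wordLength_pos v).le) hw).trans hsum)
    calc _ ≤ a w ^ (1:ℝ) * 1 := by
          refine mul_le_mul ?_ ?_ (Real.exp_pos _).le (Real.rpow_nonneg (h.pos w).le _)
          · exact Real.rpow_le_rpow_of_exponent_ge (h.pos w) hw1 hs1
          · exact Real.exp_le_one_iff.2 (by simp; positivity)
      _ ≤ _ := by simpa using hle w hw
  linarith

end ExpandingMarkovMap

namespace ExpandingMarkovMap

variable {A : Type} {M : ExpandingMarkovMap A} {g : A → ℝ → ℝ} {φ : ℝ → ℝ} {s : ℝ} {y : ℝ}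

lemma ediam_image_wordMap (hg : M.IsIFS g) (w : List A) :
    Metric.ediam (wordMap g w '' Icc 0 1) = ENNReal.ofReal (wordLength g w) := by
  rw [hg.image_wordMap, uIcc, Real.ediam_Icc, wordLength, max_sub_min_eq_abs]

lemma exists_sum_wordLength_gt (hg : M.IsIFS g) {n : ℕ} {r c : ℝ} (hc : 0 ≤ c)
    (h : ENNReal.ofReal c < ∑' S : cylinderFamily g y n r, Metric.ediam (S : Set ℝ)) :
    ∃ S : Finset (List A), (∀ w ∈ S, w.length = n ∧ wordMap g w '' Icc 0 1 ⊆ Metric.ball y r) ∧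
      c < ∑ w ∈ S, wordLength g w := by
  classical
  rw [ENNReal.tsum_eq_iSup_sum, lt_iSup_iff] at h
  obtain ⟨F, hF⟩ := h
  choose τ hτ using fun S : cylinderFamily g y n r => S.2
  have hτ1 : ∀ S : cylinderFamily g y n r,
      (S : Set ℝ) = wordMap g (List.ofFn (τ S)) '' Icc 0 1 := fun S => by
    rw [← ifsWord_eq_wordMap]
    exact (hτ S).1
  refine ⟨F.image fun S => List.ofFn (τ S), ?_, ?_⟩
  · intro w hw
    obtain ⟨S, -, rfl⟩ := Finset.mem_image.1 hw
    refine ⟨List.length_ofFn, ?_⟩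
    rw [← hτ1]
    exact (hτ S).2
  · rw [Finset.sum_image]
    · have he : ∀ S ∈ F, Metric.ediam (S : Set ℝ) =
          ENNReal.ofReal (wordLength g (List.ofFn (τ S))) := by
        intro S _
        rw [← ediam_image_wordMap hg, ← hτ1]
      rw [Finset.sum_congr rfl he,
        ← ENNReal.ofReal_sum_of_nonneg fun S _ => (hg.wordLength_pos _).le] at hF
      exact (ENNReal.ofReal_lt_ofReal_iff_of_nonneg hc).1 hF
    · intro S _ S' _ hSS
      apply Subtype.ext
      dsimp only at hSS
      rw [hτ1, hτ1, hSS]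

/-- At arbitrarily small scales `r`, a definite proportion of the ball `B(y, r)` is covered by
cylinders of a large level `n = O(-log r)` inside it. -/
lemma exists_finset_of_hasPUCD (hg : M.IsIFS g) (h : HasPUCD g y) :
    ∃ c > 0, ∃ β > 0, ∀ ε > 0, ∀ L : ℕ, ∃ r > 0, r < ε ∧ ∃ n : ℕ, L ≤ n ∧ n * β ≤ -Real.log r ∧
      ∃ S : Finset (List A), (∀ w ∈ S, w.length = n ∧ wordMap g w '' Icc 0 1 ⊆ Metric.ball y r) ∧
        c * r < ∑ w ∈ S, wordLength g w := by
  obtain ⟨lam, hlam, hlog, hsum⟩ := h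
  rw [Filter.limsup_eq] at hlog
  have hne : {a | ∀ᶠ r : ℝ in 𝓝[>] 0, Real.log r / lam r ≤ a}.Nonempty := by
    rw [nonempty_iff_ne_empty]
    intro he
    rw [he, Real.sInf_empty] at hlog
    exact lt_irrefl _ hlog
  obtain ⟨b, hb, hb0⟩ := exists_lt_of_csInf_lt hne hlog
  obtain ⟨c, hc0, hc⟩ := ENNReal.lt_iff_exists_nnreal_btwn.1 hsum
  have hc0 : (0:ℝ) < c := by exact_mod_cast hc0
  refine ⟨c, hc0, -b, neg_pos.2 hb0, fun ε hε L => ?_⟩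
  have hev : ∀ᶠ r : ℝ in 𝓝[>] 0, r ∈ Ioo 0 ε := Ioo_mem_nhdsGT hε
  obtain ⟨r, ⟨⟨hr, hbr⟩, hrε⟩, hL⟩ := (((frequently_lt_of_lt_limsup (by isBoundedDefault)
    hc).and_eventually hb).and_eventually hev |>.and_eventually
      (hlam.eventually_ge_atTop (max L 1))).exists
  have hr0 : ENNReal.ofReal r ≠ 0 := by simpa using hrε.1
  rw [mul_comm, ← div_eq_mul_inv, ENNReal.lt_div_iff_mul_lt (Or.inl hr0)
    (Or.inl ENNReal.ofReal_ne_top), ← ENNReal.ofReal_coe_nnreal,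
    ← ENNReal.ofReal_mul hc0.le] at hr
  refine ⟨r, hrε.1, hrε.2, lam r, (le_max_left _ _).trans hL, ?_,
    exists_sum_wordLength_gt hg (mul_nonneg hc0.le hrε.1.le) hr⟩
  have hl : (0:ℝ) < lam r := by exact_mod_cast (le_max_right L 1).trans hL
  rw [div_le_iff₀ hl] at hbr
  linarith

end ExpandingMarkovMap

namespace CodeStep

variable {A : Type}

/-- The state of the construction of a sequence of coding steps: the product `mass` of the ratios
and the bound `sum` of the Birkhoff sums up to the step `index`, the number `rem` of block steps
left before the next target step `target`, which has radius `radius` and increases `sum` by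
`incr`. -/
structure Schedule (A : Type) where
  mass : ℝ
  sum : ℝ
  index : ℕ
  rem : ℕ
  target : CodeStep A
  radius : ℝ
  incr : ℝ

/-- The invariant of the construction. -/
structure Schedule.Valid (B : CodeStep A) (k q : ℝ) (IsTarget : CodeStep A → ℝ → ℝ → Prop)
    (S : Schedule A) : Prop where
  mass_nonneg : 0 ≤ S.mass
  sum_nonneg : 0 ≤ S.sum
  mass_le : S.mass ≤ q ^ S.index
  isTarget : IsTarget S.target S.radius S.incr
  ratio_nonneg : 0 ≤ S.target.ratio
  incr_nonneg : 0 ≤ S.incr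
  mul_le : S.mass * B.ratio ^ S.rem * S.target.ratio ≤ q ^ (S.index + S.rem + 1)
  radius_le : S.radius ≤ Real.exp (-(S.sum + k * S.rem))

lemma exists_schedule (B : CodeStep A) {k q : ℝ} (hk : 0 ≤ k) (hB0 : 0 ≤ B.ratio)
    (hBq : B.ratio ≤ q) (IsTarget : CodeStep A → ℝ → ℝ → Prop)
    (H : ∀ (P F : ℝ) (j : ℕ), 0 ≤ P → 0 ≤ F → ∃ (N : ℕ) (t : CodeStep A) (r f : ℝ),
      IsTarget t r f ∧ 0 ≤ t.ratio ∧ 0 ≤ f ∧ P * B.ratio ^ N * t.ratio ≤ q ^ (j + N + 1) ∧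
      r ≤ Real.exp (-(F + k * N))) :
    ∃ (σ : ℕ → CodeStep A) (F r f : ℕ → ℝ), F 0 = 0 ∧
      (∀ j, ∏ i ∈ Finset.range j, (σ i).ratio ≤ q ^ j) ∧
      (∀ j, (σ j = B ∧ F (j + 1) = F j + k) ∨
        (IsTarget (σ j) (r j) (f j) ∧ F (j + 1) = F j + f j)) ∧
      ∀ m, ∃ j ≥ m, IsTarget (σ j) (r j) (f j) ∧ r j ≤ Real.exp (-F j) := by
  let step : Schedule A → CodeStep A := fun S => if S.rem = 0 then S.target else B
  have hstart : ∃ S : Schedule A, S.Valid B k q IsTarget ∧ S.mass = 1 ∧ S.sum = 0 ∧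
      S.index = 0 := by
    obtain ⟨N, t, r, f, h1, h2, h3, h4, h5⟩ := H 1 0 0 zero_le_one le_rfl
    exact ⟨⟨1, 0, 0, N, t, r, f⟩, ⟨zero_le_one, le_rfl, by simp, h1, h2, h3, h4, h5⟩,
      rfl, rfl, rfl⟩
  have hnext : ∀ S : {S : Schedule A // S.Valid B k q IsTarget},
      ∃ S' : {S : Schedule A // S.Valid B k q IsTarget},
        S'.1.index = S.1.index + 1 ∧ S'.1.mass = S.1.mass * (step S.1).ratio ∧
        S'.1.sum = S.1.sum + (if S.1.rem = 0 then S.1.incr else k) ∧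
        (S.1.rem ≠ 0 → S'.1.rem + 1 = S.1.rem) := by
    rintro ⟨⟨P, F, j, rem, t, r, f⟩, hS⟩
    cases rem with
    | zero =>
      have hP' : 0 ≤ P * t.ratio := mul_nonneg hS.mass_nonneg hS.ratio_nonneg
      have hF' : 0 ≤ F + f := add_nonneg hS.sum_nonneg hS.incr_nonneg
      obtain ⟨N, t', r', f', h1, h2, h3, h4, h5⟩ := H (P * t.ratio) (F + f) (j + 1) hP' hF'
      refine ⟨⟨⟨P * t.ratio, F + f, j + 1, N, t', r', f'⟩,
        ⟨hP', hF', ?_, h1, h2, h3, h4, h5⟩⟩, rfl, by simp [step], by simp, by simp⟩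
      simpa using hS.mul_le
    | succ i =>
      refine ⟨⟨⟨P * B.ratio, F + k, j + 1, i, t, r, f⟩,
        ⟨mul_nonneg hS.mass_nonneg hB0, add_nonneg hS.sum_nonneg hk, ?_, hS.isTarget,
          hS.ratio_nonneg, hS.incr_nonneg, ?_, ?_⟩⟩, rfl, by simp [step], by simp, by simp⟩
      · rw [pow_succ]
        exact mul_le_mul hS.mass_le hBq hB0 (hS.mass_nonneg.trans hS.mass_le)
      · have := hS.mul_le
        simp only at this ⊢
        rw [mul_assoc P, ← pow_succ', show j + 1 + i + 1 = j + (i + 1) + 1 by ring]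
        exact this
      · have := hS.radius_le
        simp only at this ⊢
        push_cast at this
        rwa [add_assoc, show k + k * (i:ℝ) = k * (i + 1) by ring]
  obtain ⟨S₀, hS₀, hP₀, hF₀, hj₀⟩ := hstart
  choose next hindex hmass hsum hrem using hnext
  let seq : ℕ → {S : Schedule A // S.Valid B k q IsTarget} := fun n => next^[n] ⟨S₀, hS₀⟩
  have hseq : ∀ n, seq (n + 1) = next (seq n) := fun n => Function.iterate_succ_apply' _ _ _
  have hidx : ∀ n, (seq n).1.index = n := by
    intro n
    induction n with
    | zero => exact hj₀
    | succ n ih => rw [hseq, hindex, ih]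
  have hprod : ∀ n, ∏ i ∈ Finset.range n, (step (seq i).1).ratio = (seq n).1.mass := by
    intro n
    induction n with
    | zero =>
      rw [Finset.prod_range_zero]
      exact hP₀.symm
    | succ n ih => rw [Finset.prod_range_succ, ih, hseq, hmass]
  refine ⟨fun j => step (seq j).1, fun j => (seq j).1.sum, fun j => (seq j).1.radius,
    fun j => (seq j).1.incr, hF₀, ?_, ?_, ?_⟩
  · intro j
    rw [hprod]
    have := (seq j).2.mass_le
    rwa [hidx] at this
  · intro j
    have h := hsum (seq j)
    rw [← hseq] at h
    by_cases h0 : (seq j).1.rem = 0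
    · rw [if_pos h0] at h
      simp only [step, if_pos h0]
      exact Or.inr ⟨(seq j).2.isTarget, h⟩
    · rw [if_neg h0] at h
      simp only [step, if_neg h0]
      exact Or.inl ⟨trivial, h⟩
  · intro m
    obtain ⟨j, hj, h0⟩ : ∃ j ≥ m, (seq j).1.rem = 0 := by
      induction hn : (seq m).1.rem generalizing m with
      | zero => exact ⟨m, le_rfl, hn⟩
      | succ n ih =>
        have h := hrem (seq m) (by omega)
        rw [← hseq, hn] at h
        obtain ⟨j, hj, h0⟩ := ih (m + 1) (by omega)
        exact ⟨j, by omega, h0⟩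
    refine ⟨j, hj, ?_, ?_⟩
    · simp only [step, if_pos h0]
      exact (seq j).2.isTarget
    · have := (seq j).2.radius_le
      rwa [h0, Nat.cast_zero, mul_zero, add_zero] at this

end CodeStep

namespace CodeStep

variable {A : Type} {M : ExpandingMarkovMap A} {g : A → ℝ → ℝ} {φ : ℝ → ℝ} {s C C' : ℝ}

lemma Admissible.mono {σ : CodeStep A} (h : σ.Admissible g s C) (hC : C ≤ C') :
    σ.Admissible g s C' := by
  refine { h with sum_le := fun w κ x d hκ hd hw S hS hSd =>
    (h.sum_le w κ x d hκ hd hw S hS hSd).trans ?_ }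
  have := Real.rpow_nonneg (div_pos hd hκ).le s
  exact mul_le_mul_of_nonneg_right (mul_le_mul_of_nonneg_right hC this) h.ratio_nonneg

/-- The step choosing a word `w` of a block system with probability proportional to `a w ^ s`. -/
noncomputable def block (G : Finset (List A)) (a : List A → ℝ) (n k : ℕ) (s : ℝ) : CodeStep A where
  words := G
  weight w := Real.exp (-(s * k)) / (∑ v ∈ G, a v ^ s * Real.exp (-(s * k))) * a w ^ s
  lower := a
  size := n
  ratio := Real.exp (-(s * k)) / (∑ v ∈ G, a v ^ s * Real.exp (-(s * k)))

lemma admissible_block {n k : ℕ} {G : Finset (List A)} {a : List A → ℝ}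
    (h : M.IsBlockSystem g φ n G a fun _ => k) (hg : M.IsIFS g) (hn : 1 ≤ n) (hs : 0 < s)
    (h1 : 1 < ∑ w ∈ G, a w ^ s * Real.exp (-(s * k))) :
    (block G a n k s).Admissible g s G.card := by
  have hZ : 0 < ∑ w ∈ G, a w ^ s * Real.exp (-(s * k)) := by linarith
  have hr : 0 < (block G a n k s).ratio := div_pos (Real.exp_pos _) hZ
  refine ⟨hn, h.length_eq, fun v => mul_nonneg hr.le (Real.rpow_nonneg (h.pos v).le _), ?_, h.pos,
    h.lowerLipschitz, hr.le, fun v _ => le_rfl, ?_⟩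
  · change ∑ v ∈ G, Real.exp (-(s * k)) / (∑ v ∈ G, a v ^ s * Real.exp (-(s * k))) * a v ^ s = 1
    rw [← Finset.mul_sum, div_mul_eq_mul_div, Finset.mul_sum]
    simp only [mul_comm (Real.exp _)]
    exact div_self hZ.ne'
  · intro w κ x d hκ hd hw S hS hSd
    calc ∑ v ∈ S, (block G a n k s).weight v
        ≤ ∑ _v ∈ S, (block G a n k s).ratio * (d / κ) ^ s := by
          refine Finset.sum_le_sum fun v hv => mul_le_mul_of_nonneg_left ?_ hr.le
          refine Real.rpow_le_rpow (h.pos v).le ?_ hs.le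
          rw [le_div_iff₀ hκ, mul_comm]
          exact (ExpandingMarkovMap.le_wordLength (ExpandingMarkovMap.lowerLipschitz_append hg
            hκ.le hw (h.lowerLipschitz v (hS hv)))).trans (hSd v hv).1.le
      _ = S.card * (d / κ) ^ s * (block G a n k s).ratio := by
          rw [Finset.sum_const, nsmul_eq_mul]
          ring
      _ ≤ G.card * (d / κ) ^ s * (block G a n k s).ratio := by
          have : (S.card : ℝ) ≤ G.card := by exact_mod_cast Finset.card_le_card hS
          have := Real.rpow_nonneg (div_pos hd hκ).le s
          gcongr

/-- The step choosing a word of `S` with probability proportional to the length of its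
interval. -/
noncomputable def lengthStep (g : A → ℝ → ℝ) (S : Finset (List A)) (ρ : ℕ → ℝ) (n : ℕ)
    (s c r : ℝ) : CodeStep A where
  words := S
  weight w := wordLength g w / ∑ v ∈ S, wordLength g v
  lower w := wordLength g w * Real.exp (-(w.length * ρ w.length))
  size := n
  ratio := 2 / c * Real.exp (s * (n * ρ n)) * r ^ (-s)

lemma admissible_lengthStep (hg : M.IsIFS g) {S : Finset (List A)} {ρ : ℕ → ℝ}
    (hρ0 : ∀ n, 0 ≤ ρ n) (hρ : ∀ w : List A,
      LowerLipschitz g w (wordLength g w * Real.exp (-(w.length * ρ w.length))))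
    {n : ℕ} (hn : 1 ≤ n) (hs0 : 0 < s) (hs1 : s < 1) {c r y : ℝ} (hc : 0 < c) (hr : 0 < r)
    (hS : ∀ w ∈ S, w.length = n ∧ wordMap g w '' Icc 0 1 ⊆ Metric.ball y r)
    (hsum : c * r < ∑ w ∈ S, wordLength g w) :
    (lengthStep g S ρ n s c r).Admissible g s ((3 / c) ^ s * (c / 2)) := by
  classical
  set W := ∑ w ∈ S, wordLength g w with hW
  have hcr : 0 < c * r := mul_pos hc hr
  have hW0 : 0 < W := hcr.trans hsum
  have hratio : 0 < (lengthStep g S ρ n s c r).ratio :=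
    mul_pos (mul_pos (by positivity) (Real.exp_pos _)) (Real.rpow_pos_of_pos hr _)
  refine ⟨hn, fun v hv => (hS v hv).1, fun v => div_nonneg (hg.wordLength_pos v).le hW0.le, ?_,
    fun v => mul_pos (hg.wordLength_pos v) (Real.exp_pos _), fun v _ => hρ v, hratio.le, ?_, ?_⟩
  · change ∑ v ∈ S, wordLength g v / W = 1
    rw [← Finset.sum_div, ← hW, div_self hW0.ne']
  · intro v hv
    change wordLength g v / W ≤ 2 / c * Real.exp (s * (n * ρ n)) * r ^ (-s) *
      (wordLength g v * Real.exp (-(v.length * ρ v.length))) ^ s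
    have hl := hg.wordLength_pos v
    have hl2 : wordLength g v ≤ 2 * r := by
      have h0 := (hS v hv).2 (mem_image_of_mem _ (left_mem_Icc.2 zero_le_one))
      have h1 := (hS v hv).2 (mem_image_of_mem _ (right_mem_Icc.2 zero_le_one))
      rw [Metric.mem_ball, Real.dist_eq, abs_lt] at h0 h1
      rw [wordLength, abs_le]
      constructor <;> linarith
    have hpow : wordLength g v ^ (1 - s) ≤ 2 * r ^ (1 - s) := by
      calc _ ≤ (2 * r) ^ (1 - s) := Real.rpow_le_rpow hl.le hl2 (by linarith)
        _ = 2 ^ (1 - s) * r ^ (1 - s) := Real.mul_rpow zero_le_two hr.le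
        _ ≤ 2 ^ (1:ℝ) * r ^ (1 - s) := by
          refine mul_le_mul_of_nonneg_right ?_ (Real.rpow_nonneg hr.le _)
          exact Real.rpow_le_rpow_of_exponent_le one_le_two (by linarith)
        _ = _ := by rw [Real.rpow_one]
    rw [(hS v hv).1, Real.mul_rpow hl.le (Real.exp_pos _).le, ← Real.exp_mul]
    calc wordLength g v / W ≤ wordLength g v / (c * r) := by gcongr
      _ = wordLength g v ^ (1 - s) * wordLength g v ^ s / (c * r) := by
          rw [← Real.rpow_add hl, sub_add_cancel, Real.rpow_one]
      _ ≤ 2 * r ^ (1 - s) * wordLength g v ^ s / (c * r) := by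
          have := Real.rpow_nonneg hl.le s
          gcongr
      _ = 2 / c * r ^ (-s) * wordLength g v ^ s *
          (Real.exp (s * (n * ρ n)) * Real.exp (-(n * ρ n) * s)) := by
          rw [← Real.exp_add, show s * (n * ρ n) + -(n * ρ n) * s = 0 by ring, Real.exp_zero,
            mul_one, sub_eq_add_neg, Real.rpow_add hr, Real.rpow_one]
          field_simp
      _ = _ := by ring
  · intro w κ x d hκ hd hw F hF hFd
    change ∑ v ∈ F, wordLength g v / W ≤ (3 / c) ^ s * (c / 2) * (d / κ) ^ s *
      (2 / c * Real.exp (s * (n * ρ n)) * r ^ (-s))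
    have hlen : κ * ∑ v ∈ F, wordLength g v ≤ 3 * d := by
      have h := hg.sum_min_le (F.image (w ++ ·)) (n := w.length + n) (x := x) (d := d) ?_ hd ?_
      · rw [Finset.sum_image fun _ _ _ _ h => List.append_cancel_left h] at h
        rw [Finset.mul_sum]
        refine (Finset.sum_le_sum fun v hv => ?_).trans h
        rw [min_eq_left (hFd v hv).1.le]
        exact ExpandingMarkovMap.mul_wordLength_le hg hw v
      · intro u hu
        obtain ⟨v, hv, rfl⟩ := Finset.mem_image.1 hu
        rw [List.length_append, (hS v (hF hv)).1]
      · intro u hu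
        obtain ⟨v, hv, rfl⟩ := Finset.mem_image.1 hu
        exact (hFd v hv).2
    set θ := ∑ v ∈ F, wordLength g v / W with hθ
    have hθ0 : 0 ≤ θ := Finset.sum_nonneg fun v _ => div_nonneg (hg.wordLength_pos v).le hW0.le
    have hθ1 : θ ≤ 1 := by
      rw [hθ, ← Finset.sum_div, div_le_one hW0]
      exact Finset.sum_le_sum_of_subset_of_nonneg hF fun v _ _ => (hg.wordLength_pos v).le
    have hθ2 : θ ≤ 3 / c * (d / κ) * r⁻¹ := by
      have hle : ∑ v ∈ F, wordLength g v ≤ 3 * (d / κ) := by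
        rw [← mul_div_assoc, le_div_iff₀ hκ]
        linarith
      calc θ = (∑ v ∈ F, wordLength g v) / W := by rw [hθ, ← Finset.sum_div]
        _ ≤ 3 * (d / κ) / (c * r) := by gcongr
        _ = _ := by field_simp
    have hdκ := div_pos hd hκ
    calc θ = θ ^ (1:ℝ) := (Real.rpow_one _).symm
      _ ≤ θ ^ s := Real.rpow_le_rpow_of_exponent_ge' hθ0 hθ1 hs0.le hs1.le
      _ ≤ (3 / c * (d / κ) * r⁻¹) ^ s := Real.rpow_le_rpow hθ0 hθ2 hs0.le
      _ = (3 / c) ^ s * (d / κ) ^ s * r ^ (-s) * 1 := by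
          rw [Real.mul_rpow (by positivity) (by positivity),
            Real.mul_rpow (by positivity) hdκ.le, Real.inv_rpow hr.le, Real.rpow_neg hr.le, mul_one]
      _ ≤ (3 / c) ^ s * (d / κ) ^ s * r ^ (-s) * Real.exp (s * (n * ρ n)) := by
          refine mul_le_mul_of_nonneg_left ?_ (by positivity)
          exact Real.one_le_exp (mul_nonneg hs0.le (mul_nonneg (Nat.cast_nonneg _) (hρ0 n)))
      _ = _ := by
          field_simp

end CodeStep

namespace ExpandingMarkovMap

variable {A : Type} {M : ExpandingMarkovMap A} {g : A → ℝ → ℝ} {φ : ℝ → ℝ} {s : ℝ} {y : ℝ}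

/-- Choice of a scale `r` and of a number `N` of block steps with `exp (-k * N) ≈ r` such that
the gain of the block steps outweighs the loss of the target step. -/
lemma exists_scale {ρ : ℕ → ℝ} (hρ : Tendsto ρ atTop (𝓝 0)) {c β Q k F P : ℝ} (hc : 0 < c)
    (hβ : 0 < β) (hs : 0 < s) (hQ : 1 < Q) (hk : 0 < k) (hP : 0 ≤ P) {p : ℝ → ℕ → Prop}
    (h : ∀ ε > 0, ∀ L : ℕ, ∃ r > 0, r < ε ∧ ∃ n : ℕ, L ≤ n ∧ n * β ≤ -Real.log r ∧ p r n)
    (j : ℕ) :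
    ∃ (N : ℕ) (r : ℝ) (n : ℕ), 0 < r ∧ 1 ≤ n ∧ p r n ∧
      P * (Real.exp (-(s * k)) / Q) ^ N * (2 / c * Real.exp (s * (n * ρ n)) * r ^ (-s)) ≤
        Real.exp (-(Real.log Q / 4)) ^ (j + N + 1) ∧ r ≤ Real.exp (-(F + k * N)) := by
  have hQ0 : 0 < Q := by linarith
  set l := Real.log Q with hl
  have hl0 : 0 < l := Real.log_pos hQ
  set E := Real.log (P + 1) + Real.log (2 / c) + l * F / (2 * k) + l / 2 + s * F + s * k with hE
  set N₀ := max 0 (4 / l * (E + l * (j + 1) / 4)) with hN₀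
  obtain ⟨L, hL⟩ := eventually_atTop.1 (hρ.eventually_lt_const
    (show (0:ℝ) < l * β / (2 * s * k) by positivity))
  obtain ⟨r, hr, hrε, n, hLn, hnβ, hp⟩ := h (Real.exp (-(F + k * (N₀ + 1)))) (Real.exp_pos _)
    (max L 1)
  have hρn := (hL n ((le_max_left _ _).trans hLn)).le
  have hn1 : 1 ≤ n := (le_max_right _ _).trans hLn
  set u := -Real.log r with hu
  have hur : r = Real.exp (-u) := by rw [hu, neg_neg, Real.exp_log hr]
  have huF : F + k * (N₀ + 1) < u := by
    rw [hur, Real.exp_lt_exp] at hrε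
    linarith
  have hN₀0 : 0 ≤ N₀ := le_max_left _ _
  have hdiv0 : N₀ + 1 < (u - F) / k := by
    rw [lt_div_iff₀ hk]
    linarith
  set N := ⌊(u - F) / k⌋₊ with hN
  have hN1 : k * N ≤ u - F := by
    have := Nat.floor_le (show 0 ≤ (u - F) / k by linarith)
    rw [le_div_iff₀ hk] at this
    linarith
  have hN2' : (u - F) / k < N + 1 := Nat.lt_floor_add_one _
  have hN2 : u - F ≤ k * (N + 1) := by
    rw [div_lt_iff₀ hk] at hN2'
    linarith
  have hNN : N₀ ≤ N := by linarith
  have hNl : E + l * (j + 1) / 4 ≤ N * l / 4 := by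
    have h1 := (le_max_right _ _).trans hNN
    rw [div_mul_eq_mul_div, div_le_iff₀ hl0] at h1
    linarith
  have hdist : s * (n * ρ n) ≤ l * F / (2 * k) + l * (N + 1) / 2 := by
    have hu0 : 0 ≤ u := le_trans (by positivity) hnβ
    calc s * (n * ρ n) ≤ s * (n * (l * β / (2 * s * k))) := by gcongr
      _ = (n * β) * (l / (2 * k)) := by field_simp
      _ ≤ (F + k * (N + 1)) * (l / (2 * k)) := by
          gcongr
          linarith
      _ = _ := by field_simp
  have hsu : s * u ≤ s * F + s * k * (N + 1) := by
    have := mul_le_mul_of_nonneg_left hN2 hs.le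
    linarith
  refine ⟨N, r, n, hr, hn1, hp, ?_, ?_⟩
  · calc P * (Real.exp (-(s * k)) / Q) ^ N * (2 / c * Real.exp (s * (n * ρ n)) * r ^ (-s))
        ≤ (P + 1) * (Real.exp (-(s * k)) / Q) ^ N *
          (2 / c * Real.exp (s * (n * ρ n)) * r ^ (-s)) := by
          gcongr
          linarith
      _ = Real.exp (Real.log (P + 1) + N * (-(s * k) - l) +
          (Real.log (2 / c) + s * (n * ρ n) + s * u)) := by
          have h1 : Real.exp (Real.log (P + 1)) = P + 1 := Real.exp_log (by linarith)
          have h2 : Real.exp (Real.log (2 / c)) = 2 / c := Real.exp_log (by positivity)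
          have h3 : Real.exp l = Q := Real.exp_log hQ0
          have h4 : r ^ (-s) = Real.exp (s * u) := by
            rw [Real.rpow_def_of_pos hr, hu]
            ring_nf
          rw [Real.exp_add, Real.exp_add, Real.exp_add, Real.exp_add, Real.exp_nat_mul,
            Real.exp_sub, h1, h2, h3, h4]
      _ ≤ Real.exp ((j + N + 1 : ℕ) * (-(l / 4))) := by
          rw [Real.exp_le_exp]
          push_cast
          nlinarith
      _ = _ := by rw [Real.exp_nat_mul]
  · rw [hur, Real.exp_le_exp]
    linarith

lemma Tempered.exists_birkhoff_le_finset (hφ : M.Tempered φ) (S : Finset (List A)) :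
    ∃ f, 0 ≤ f ∧ ∀ v ∈ S, ∀ x ∈ M.listCylinder v ∩ M.repeller, M.birkhoff φ v.length x ≤ f := by
  choose f hf0 hf using hφ.exists_birkhoff_le
  exact ⟨∑ v ∈ S, f v, Finset.sum_nonneg fun v _ => hf0 v, fun v hv x hx =>
    (hf v x hx).trans (Finset.single_le_sum (fun v _ => hf0 v) hv)⟩

/-- The points coded by a code all of whose coding intervals contain them in their interior lie
in the shrinking target set, if the steps of the code hit the targets infinitely often. -/
lemma mem_shrinkingTarget_of_code (hg : M.IsIFS g) {C : ℝ} {σ : ℕ → CodeStep A}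
    (hσ : ∀ j, (σ j).Admissible g s C) {F r : ℕ → ℝ} (hF0 : F 0 = 0)
    (hF : ∀ j, ∀ v ∈ (σ j).words, ∀ x ∈ M.listCylinder v ∩ M.repeller,
      M.birkhoff φ v.length x ≤ F (j + 1) - F j)
    (hr : ∀ m, ∃ j ≥ m, (∀ v ∈ (σ j).words, wordMap g v '' Icc 0 1 ⊆ Metric.ball y (r j)) ∧
      r j ≤ Real.exp (-F j))
    (ω : Code σ) {x : ℝ} (hx : ∀ j, x ∈ wordMap g (ω.word j) '' Ioo 0 1) :
    x ∈ M.shrinkingTarget y φ := by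
  have hcyl : ∀ j, x ∈ M.listCylinder (ω.word j) := by
    intro j
    obtain ⟨t, ht, rfl⟩ := hx j
    exact (hg.wordMap_Ioo _ ht).2.1
  have hrep : x ∈ M.repeller := fun n => mem_iUnion.2
    ⟨_, (M.mem_listCylinder_iff _ x).1 (hcyl (n + 1)) ⟨n, Code.le_length_word hσ ω (n + 1)⟩⟩
  have hbirk : ∀ j, M.birkhoff φ (ω.word j).length x ≤ F j := by
    intro j
    induction j with
    | zero => simp [Code.word, birkhoff, hF0]
    | succ j ih =>
      have h := hcyl (j + 1)
      rw [Code.word, listCylinder_append] at h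
      have := hF j _ (ω j).2 _ ⟨h.2, iterate_mem_repeller hrep _⟩
      rw [Code.word, List.length_append, birkhoff_add]
      linarith
  refine mem_iInter.2 fun m => ?_
  obtain ⟨j, hj, hball, hrj⟩ := hr m
  refine mem_iUnion₂.2 ⟨(ω.word j).length, hj.trans (Code.le_length_word hσ ω j), hrep, ?_⟩
  obtain ⟨t, ht, he⟩ := hx (j + 1)
  rw [Code.word, wordMap_append, Function.comp_apply] at he
  have h1 := hg.wordMap_Ioo (ω.word j) (hg.wordMap_Ioo (ω j : List A) ht).1
  rw [he] at h1
  rw [h1.2.2.1]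
  have h2 := hball _ (ω j).2 (mem_image_of_mem _ (Ioo_subset_Icc_self ht))
  rw [Metric.mem_ball, Real.dist_eq] at h2
  exact h2.trans_le (hrj.trans (Real.exp_le_exp.2 (neg_le_neg (hbirk j))))

/-- If the pressure of `-s (ψ + φ)` is positive, then the shrinking target set has dimension at
least `s`. -/
lemma le_dimH_shrinkingTarget_of_pressure_pos (hg : M.IsIFS g) (hPUCD : HasPUCD g y)
    (hφ0 : ∀ x ∈ M.repeller, 0 ≤ φ x) (hφ : M.Tempered φ) (hs : 0 < s)
    (hP : 0 < M.pressure (fun x => -s * (M.psi x + φ x))) :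
    ENNReal.ofReal s ≤ dimH (M.shrinkingTarget y φ) := by
  obtain ⟨n₀, G₀, a₀, k₀, hn₀, hG₀, hsum₀⟩ := exists_isBlockSystem hg hφ0 hφ hs hP
  obtain ⟨m, G, a, k, hm, hk, hG, hsum⟩ := hG₀.exists_uniform hg hn₀ hsum₀
  have hs1 := hG.lt_one hg hs hsum
  have hk0 : (0:ℝ) < k := by exact_mod_cast hk
  obtain ⟨c, hc, β, hβ, hscale⟩ := exists_finset_of_hasPUCD hg hPUCD
  obtain ⟨ρ, hρ0, hρ, hρL⟩ := M.exists_lowerLipschitz_wordLength hg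
  set Q := ∑ w ∈ G, a w ^ s * Real.exp (-(s * k)) with hQ
  have hl0 : 0 < Real.log Q := Real.log_pos hsum
  set C := max (G.card : ℝ) ((3 / c) ^ s * (c / 2)) with hC
  set q := Real.exp (-(Real.log Q / 4)) with hq
  set B := CodeStep.block G a m k s with hB
  have hBadm : B.Admissible g s C :=
    (CodeStep.admissible_block hG hg hm hs hsum).mono (le_max_left _ _)
  have hBratio : B.ratio = Real.exp (-(s * k)) / Q := rfl
  have hBq : B.ratio ≤ q := by
    rw [hBratio, hq]
    conv_lhs => rw [← Real.exp_log (show 0 < Q by linarith), ← Real.exp_sub]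
    rw [Real.exp_le_exp]
    nlinarith
  obtain ⟨σ, F, r, f, hF0, hprod, hstep, hinf⟩ := CodeStep.exists_schedule B hk0.le
    hBadm.ratio_nonneg hBq
    (fun t r f => t.Admissible g s C ∧
      (∀ v ∈ t.words, wordMap g v '' Icc 0 1 ⊆ Metric.ball y r) ∧
      ∀ v ∈ t.words, ∀ x ∈ M.listCylinder v ∩ M.repeller, M.birkhoff φ v.length x ≤ f) (by
    intro P F j hP hF
    obtain ⟨N, r, n, hr, hn, ⟨S, hS, hSsum⟩, hle, hrF⟩ :=
      exists_scale (F := F) hρ hc hβ hs hsum hk0 hP hscale j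
    obtain ⟨f, hf0, hf⟩ := hφ.exists_birkhoff_le_finset S
    have hadm := CodeStep.admissible_lengthStep hg hρ0 hρL hn hs hs1 hc hr hS hSsum
    exact ⟨N, CodeStep.lengthStep g S ρ n s c r, r, f,
      ⟨hadm.mono (le_max_right _ _), fun v hv => (hS v hv).2, hf⟩, hadm.ratio_nonneg, hf0,
      hle, hrF⟩)
  have hσ : ∀ j, (σ j).Admissible g s C := by
    intro j
    rcases hstep j with ⟨h, -⟩ | ⟨h, -⟩
    · rwa [h]
    · exact h.1
  have hF : ∀ j, ∀ v ∈ (σ j).words, ∀ x ∈ M.listCylinder v ∩ M.repeller,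
      M.birkhoff φ v.length x ≤ F (j + 1) - F j := by
    intro j v hv x hx
    rcases hstep j with ⟨h, hj⟩ | ⟨h, hj⟩
    · rw [hj, add_sub_cancel_left]
      rw [h] at hv
      rw [hG.length_eq v hv]
      exact hG.birkhoff_le v hv x hx
    · rw [hj, add_sub_cancel_left]
      exact h.2.2 v hv x hx
  have := M.countable
  set D := ⋃ w : List A, {wordMap g w 0, wordMap g w 1} with hD
  have hDc : D.Countable := countable_iUnion fun w => (toFinite _).countable
  have hpos := Code.hausdorffMeasure_pos hg hs ((Nat.cast_nonneg _).trans (le_max_left _ _)) hσ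
    (Real.exp_pos _).le (Real.exp_lt_one_iff.2 (by linarith)) hprod
    (D := M.shrinkingTarget y φ ∪ D) (by
    intro ω x hx
    by_cases hxD : x ∈ D
    · exact Or.inr hxD
    refine Or.inl (mem_shrinkingTarget_of_code hg hσ hF0 hF (r := r) ?_ ω fun j => ?_)
    · intro m
      obtain ⟨j, hj, h, hrj⟩ := hinf m
      exact ⟨j, hj, h.2.1, hrj⟩
    · obtain ⟨t, ht, rfl⟩ := hx j
      refine ⟨t, ⟨lt_of_le_of_ne ht.1 ?_, lt_of_le_of_ne ht.2 ?_⟩, rfl⟩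
      · rintro rfl
        exact hxD (mem_iUnion.2 ⟨ω.word j, Or.inl rfl⟩)
      · rintro rfl
        exact hxD (mem_iUnion.2 ⟨ω.word j, Or.inr rfl⟩))
  rw [← Real.coe_toNNReal s hs.le] at hpos
  have hdim := le_dimH_of_hausdorffMeasure_ne_zero hpos.ne'
  rwa [dimH_union, hDc.dimH_zero, max_eq_left zero_le] at hdim

end ExpandingMarkovMap

/-- **Lower bound.** If the iterated function system associated to an expanding Markov map
has positive upper cylinder density at `y ∈ closure Λ`, then for every non-negative potential
`φ` satisfying the tempered distortion condition, `dim D_y(φ) ≥ s(φ)`. -/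
theorem le_dimH_shrinkingTarget_of_hasPUCD {A : Type} (M : ExpandingMarkovMap A)
    (g : A → ℝ → ℝ) (hg : M.IsIFS g) (y : ℝ) (hy : y ∈ closure M.repeller)
    (hPUCD : HasPUCD g y)
    (φ : ℝ → ℝ) (hφ0 : ∀ x ∈ M.repeller, 0 ≤ φ x) (hφ : M.Tempered φ) :
    ENNReal.ofReal (M.sdim φ) ≤ dimH (M.shrinkingTarget y φ) := by
  rcases le_or_gt (M.sdim φ) 0 with h0 | h0
  · rw [ENNReal.ofReal_of_nonpos h0]
    exact zero_le
  have hbdd : BddBelow {s : ℝ | M.pressure (fun x => -s * (M.psi x + φ x)) ≤ 0} := by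
    by_contra hb
    rw [ExpandingMarkovMap.sdim, Real.sInf_of_not_bddBelow hb] at h0
    exact lt_irrefl _ h0
  have hlt : ∀ s ∈ Ioo 0 (M.sdim φ), ENNReal.ofReal s ≤ dimH (M.shrinkingTarget y φ) := by
    intro s hs
    refine ExpandingMarkovMap.le_dimH_shrinkingTarget_of_pressure_pos hg hPUCD hφ0 hφ hs.1 ?_
    by_contra! hP
    exact hs.2.not_ge (csInf_le hbdd hP)
  refine le_of_tendsto (ENNReal.continuous_ofReal.continuousAt.tendsto.mono_left
    (nhdsWithin_le_nhds (s := Iio (M.sdim φ)))) ?_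
  filter_upwards [Ioo_mem_nhdsLT h0] with s hs using hlt s hs
end

section
/- Let T be an expanding Markov map with repeller Λ. Then the corresponding iterated function system {φ_i}_{i∈A} has positive upper cylinder density at every y ∈ Λ. -/
open Set Filter Topology

/-- The composition along a nonempty word splits off the first map. -/
lemma ifsWord_succ {A : Type} (g : A → ℝ → ℝ) {n : ℕ} (τ : Fin (n + 1) → A) :
    ifsWord g τ = g (τ 0) ∘ ifsWord g (fun ν => τ ν.succ) := by
  simp [ifsWord, List.ofFn_succ]

namespace ExpandingMarkovMap

variable {A : Type} {M : ExpandingMarkovMap A} {g : A → ℝ → ℝ}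

lemma interior_V_subset_Ioo (i : A) : interior (M.V i) ⊆ Ioo (0 : ℝ) 1 := by
  simpa using interior_mono (M.V_subset i)

namespace IsIFS

lemma mem_interior (hg : M.IsIFS g) (i : A) {t : ℝ} (ht : t ∈ Ioo (0 : ℝ) 1) :
    g i t ∈ interior (M.V i) ∧ M.T (g i t) = t := by
  rw [← M.T_maps_interior i] at ht
  obtain ⟨x, hx, rfl⟩ := ht
  rw [(hg i).2.2 x (interior_subset hx)]
  exact ⟨hx, rfl⟩

lemma hasDerivAt (hg : M.IsIFS g) (i : A) {t : ℝ} (ht : t ∈ Ioo (0 : ℝ) 1) :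
    HasDerivAt (g i) (M.T' (g i t))⁻¹ t := by
  obtain ⟨hx, -⟩ := hg.mem_interior i ht
  have hgd : HasDerivAt (g i) (deriv (g i) t) t :=
    (((hg i).1.differentiableOn one_ne_zero).differentiableAt
      (Icc_mem_nhds ht.1 ht.2)).hasDerivAt
  have hT : HasDerivAt M.T (M.T' (g i t)) (g i t) :=
    (M.T_hasDeriv i _ (interior_subset hx)).hasDerivAt (mem_interior_iff_mem_nhds.mp hx)
  have hid : HasDerivAt (M.T ∘ g i) 1 t :=
    (hasDerivAt_id t).congr_of_eventuallyEq <| by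
      filter_upwards [Ioo_mem_nhds ht.1 ht.2] with s hs
      exact (hg.mem_interior i hs).2
  have h := (hT.comp t hgd).unique hid
  rwa [eq_inv_of_mul_eq_one_right h] at hgd

lemma ifsWord_mem_Ioo (hg : M.IsIFS g) {n : ℕ} (τ : Fin n → A) {t : ℝ}
    (ht : t ∈ Ioo (0 : ℝ) 1) : ifsWord g τ t ∈ Ioo (0 : ℝ) 1 := by
  induction n with
  | zero => simpa [ifsWord] using ht
  | succ n ih =>
    rw [ifsWord_succ]
    exact interior_V_subset_Ioo _ (hg.mem_interior _ (ih _)).1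

lemma ifsWord_mem_cylinder (hg : M.IsIFS g) {n : ℕ} (τ : Fin n → A) {t : ℝ}
    (ht : t ∈ Ioo (0 : ℝ) 1) : ifsWord g τ t ∈ M.cylinder τ := by
  induction n with
  | zero => exact fun ν => ν.elim0
  | succ n ih =>
    have h := hg.mem_interior (τ 0) (hg.ifsWord_mem_Ioo (fun ν => τ ν.succ) ht)
    rw [ifsWord_succ]
    intro ν
    refine Fin.cases (interior_subset h.1) (fun ν => ?_) ν
    simpa [Function.iterate_succ_apply, h.2] using ih (fun ν => τ ν.succ) ν

lemma iterate_ifsWord (hg : M.IsIFS g) {n : ℕ} (τ : Fin n → A) {t : ℝ}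
    (ht : t ∈ Ioo (0 : ℝ) 1) : M.T^[n] (ifsWord g τ t) = t := by
  induction n with
  | zero => simp [ifsWord]
  | succ n ih =>
    have h := hg.mem_interior (τ 0) (hg.ifsWord_mem_Ioo (fun ν => τ ν.succ) ht)
    rw [ifsWord_succ, Function.comp_apply, Function.iterate_succ_apply, h.2, ih]

lemma hasDerivAt_ifsWord (hg : M.IsIFS g) {n : ℕ} (τ : Fin n → A) {t : ℝ}
    (ht : t ∈ Ioo (0 : ℝ) 1) :
    HasDerivAt (ifsWord g τ)
      (∏ l ∈ Finset.range n, M.T' (M.T^[l] (ifsWord g τ t)))⁻¹ t := by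
  induction n with
  | zero => simpa [ifsWord] using hasDerivAt_id t
  | succ n ih =>
    have hm := hg.ifsWord_mem_Ioo (fun ν => τ ν.succ) ht
    have h := hg.mem_interior (τ 0) hm
    rw [ifsWord_succ]
    refine ((hg.hasDerivAt (τ 0) hm).comp t (ih fun ν => τ ν.succ)).congr_deriv ?_
    rw [Finset.prod_range_succ', Function.comp_apply, mul_inv, mul_comm]
    simp only [Function.iterate_succ_apply, h.2, Function.iterate_zero, id]

lemma mapsTo_Icc_s5 (hg : M.IsIFS g) (i : A) : MapsTo (g i) (Icc 0 1) (Icc 0 1) :=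
  (hg i).2.1.mono_right (closure_minimal (M.V_subset i) isClosed_Icc)

lemma ifsWord_mapsTo (hg : M.IsIFS g) {n : ℕ} (τ : Fin n → A) :
    MapsTo (ifsWord g τ) (Icc 0 1) (Icc 0 1) := by
  induction n with
  | zero => simpa [ifsWord] using mapsTo_id _
  | succ n ih =>
    rw [ifsWord_succ]
    exact (hg.mapsTo_Icc_s5 _).comp (ih _)

lemma continuousOn_ifsWord (hg : M.IsIFS g) {n : ℕ} (τ : Fin n → A) :
    ContinuousOn (ifsWord g τ) (Icc 0 1) := by
  induction n with
  | zero => simpa [ifsWord] using continuousOn_id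
  | succ n ih =>
    rw [ifsWord_succ]
    exact (hg _).1.continuousOn.comp (ih _) (hg.ifsWord_mapsTo _)

lemma ifsWord_iterate (hg : M.IsIFS g) {n : ℕ} (τ : Fin n → A) {y : ℝ}
    (hy : y ∈ M.cylinder τ) : ifsWord g τ (M.T^[n] y) = y := by
  induction n generalizing y with
  | zero => simp [ifsWord]
  | succ n ih =>
    rw [ifsWord_succ, Function.comp_apply, Function.iterate_succ_apply,
      ih (fun ν => τ ν.succ) fun ν => by
        simpa [Function.iterate_succ_apply] using hy ν.succ]
    exact (hg _).2.2 _ (hy 0)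

lemma diam_ifsWord_le (hg : M.IsIFS g) {n : ℕ} (τ : Fin n → A) {c : ℝ} (hc : 0 < c)
    (h : ∀ x ∈ M.cylinder τ, c < ∏ l ∈ Finset.range n, |M.T' (M.T^[l] x)|) :
    Metric.diam (ifsWord g τ '' Icc 0 1) ≤ c⁻¹ := by
  have key : ∀ a ∈ Icc (0 : ℝ) 1, ∀ b ∈ Icc (0 : ℝ) 1, a < b →
      dist (ifsWord g τ a) (ifsWord g τ b) ≤ c⁻¹ := by
    intro a ha b hb hab
    have hsub : Ioo a b ⊆ Ioo 0 1 := Ioo_subset_Ioo ha.1 hb.2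
    obtain ⟨s, hs, hslope⟩ := exists_deriv_eq_slope (ifsWord g τ) hab
      ((hg.continuousOn_ifsWord τ).mono (Icc_subset_Icc ha.1 hb.2))
      fun s hs => (hg.hasDerivAt_ifsWord τ (hsub hs)).differentiableAt.differentiableWithinAt
    have hle : |deriv (ifsWord g τ) s| ≤ c⁻¹ := by
      rw [(hg.hasDerivAt_ifsWord τ (hsub hs)).deriv, abs_inv, Finset.abs_prod]
      exact inv_anti₀ hc (h _ (hg.ifsWord_mem_cylinder τ (hsub hs))).le
    rw [eq_div_iff (sub_pos.mpr hab).ne'] at hslope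
    rw [dist_comm, Real.dist_eq, ← hslope, abs_mul, abs_of_pos (sub_pos.mpr hab)]
    have h1 : b - a ≤ 1 := by linarith [ha.1, hb.2]
    calc _ ≤ c⁻¹ * 1 := mul_le_mul hle h1 (sub_pos.mpr hab).le (inv_pos.mpr hc).le
      _ = c⁻¹ := mul_one _
  refine Metric.diam_le_of_forall_dist_le (inv_pos.mpr hc).le ?_
  rintro _ ⟨a, ha, rfl⟩ _ ⟨b, hb, rfl⟩
  rcases lt_trichotomy a b with hab | rfl | hab
  · exact key a ha b hb hab
  · simpa using hc.le
  · rw [dist_comm]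
    exact key b hb a ha hab

lemma isBounded_ifsWord (hg : M.IsIFS g) {n : ℕ} (τ : Fin n → A) :
    Bornology.IsBounded (ifsWord g τ '' Icc 0 1) :=
  (Metric.isBounded_Icc 0 1).subset (hg.ifsWord_mapsTo τ).image_subset

lemma diam_ifsWord_pos (hg : M.IsIFS g) {n : ℕ} (τ : Fin n → A) :
    0 < Metric.diam (ifsWord g τ '' Icc 0 1) := by
  have h1 : (1 / 3 : ℝ) ∈ Ioo (0 : ℝ) 1 := by norm_num
  have h2 : (1 / 2 : ℝ) ∈ Ioo (0 : ℝ) 1 := by norm_num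
  refine Metric.diam_pos ⟨_, mem_image_of_mem _ (Ioo_subset_Icc_self h1), _,
    mem_image_of_mem _ (Ioo_subset_Icc_self h2), fun h => ?_⟩ (hg.isBounded_ifsWord τ)
  have h' := congrArg M.T^[n] h
  rw [hg.iterate_ifsWord τ h1, hg.iterate_ifsWord τ h2] at h'
  norm_num at h'

end IsIFS

end ExpandingMarkovMap

/-- A system has positive upper cylinder density at `y` as soon as `y` lies, for every `n`, in a
cylinder of level `n` whose diameter is positive and decays exponentially in `n`. -/
lemma hasPUCD_of_cylinders {A : Type} {g : A → ℝ → ℝ} {y : ℝ} (τ : ∀ n : ℕ, Fin n → A)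
    (hbdd : ∀ n, Bornology.IsBounded (ifsWord g (τ n) '' Icc 0 1))
    (hpos : ∀ n, 0 < Metric.diam (ifsWord g (τ n) '' Icc 0 1))
    (hmem : ∀ n, y ∈ ifsWord g (τ n) '' Icc 0 1) {ξ : ℝ} (hξ : 1 < ξ)
    (hle : ∀ᶠ n in atTop, Metric.diam (ifsWord g (τ n) '' Icc 0 1) ≤ (ξ ^ n)⁻¹) :
    HasPUCD g y := by
  set D : ℕ → ℝ := fun n => Metric.diam (ifsWord g (τ n) '' Icc 0 1)
  classical
  set lam : ℝ → ℕ := fun r =>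
    if h : ∃ n, 2 * D n = r then h.choose else ⌈-Real.log r⌉₊ with hlam
  have lam_of : ∀ r, (∃ n, 2 * D n = r) → 2 * D (lam r) = r := fun r h => by
    simp only [hlam, dif_pos h]
    exact h.choose_spec
  have lam_not : ∀ r, (¬ ∃ n, 2 * D n = r) → lam r = ⌈-Real.log r⌉₊ := fun r h => by
    simp only [hlam, dif_neg h]
  have hlog : Tendsto (fun r => -Real.log r) (𝓝[>] (0 : ℝ)) atTop :=
    tendsto_neg_atBot_atTop.comp Real.tendsto_log_nhdsGT_zero
  have hlam_top : Tendsto lam (𝓝[>] (0 : ℝ)) atTop := by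
    refine tendsto_atTop.mpr fun K => ?_
    have h1 : ∀ᶠ r in 𝓝[>] (0 : ℝ), ∀ j ∈ Finset.range K, r < 2 * D j :=
      (Filter.eventually_all_finset _).mpr fun j _ =>
        nhdsWithin_le_nhds (Iio_mem_nhds (mul_pos two_pos (hpos j)))
    filter_upwards [h1, hlog.eventually_ge_atTop (K : ℝ)] with r hr hrK
    by_cases h : ∃ n, 2 * D n = r
    · by_contra! hlt
      exact absurd (lam_of r h) (hr _ (Finset.mem_range.mpr hlt)).ne'
    · rw [lam_not r h]
      exact_mod_cast hrK.trans (Nat.le_ceil _)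
  have hlogξ : 0 < Real.log ξ := Real.log_pos hξ
  refine ⟨lam, hlam_top, ?_, ?_⟩
  · have hup : ∀ᶠ r in 𝓝[>] (0 : ℝ),
        Real.log r / (lam r : ℝ) ≤ -min (Real.log ξ / 2) (1 / 2) := by
      have hbig : ∀ᶠ n : ℕ in atTop, Real.log 2 ≤ n * (Real.log ξ / 2) :=
        (tendsto_natCast_atTop_atTop.atTop_mul_const (half_pos hlogξ)).eventually_ge_atTop _
      filter_upwards [hlam_top.eventually hle, hlam_top.eventually hbig,
        hlam_top.eventually_gt_atTop 0, hlog.eventually_ge_atTop 1] with r hr1 hr2 hr3 hr4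
      have hl : (0 : ℝ) < lam r := by exact_mod_cast hr3
      rw [div_le_iff₀ hl]
      by_cases h : ∃ n, 2 * D n = r
      · have hlogD : Real.log (D (lam r)) ≤ -(lam r * Real.log ξ) := by
          rw [← Real.log_pow, ← Real.log_inv]
          exact Real.log_le_log (hpos _) hr1
        have hlogr : Real.log r = Real.log 2 + Real.log (D (lam r)) := by
          rw [← Real.log_mul two_ne_zero (hpos _).ne', lam_of r h]
        have := mul_le_mul_of_nonneg_right (min_le_left (Real.log ξ / 2) (1 / 2)) hl.le
        linarith
      · have h1 := (Nat.ceil_lt_add_one (show 0 ≤ -Real.log r by linarith)).le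
        rw [← lam_not r h] at h1
        have := mul_le_mul_of_nonneg_right (min_le_right (Real.log ξ / 2) (1 / 2)) hl.le
        linarith
    have hfreq : ∃ᶠ r in 𝓝[>] (0 : ℝ), (-1 : ℝ) ≤ Real.log r / (lam r : ℝ) := by
      have hdense : Dense (range fun n => 2 * D n)ᶜ := (countable_range _).dense_compl ℝ
      have hout : ∃ᶠ r in 𝓝[>] (0 : ℝ), r ∉ range fun n => 2 * D n := by
        refine (nhdsGT_basis (0 : ℝ)).frequently_iff.mpr fun ε hε => ?_
        obtain ⟨r, hr, hr'⟩ := hdense.exists_mem_open isOpen_Ioo (nonempty_Ioo.mpr hε)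
        exact ⟨r, hr', hr⟩
      refine (hout.and_eventually (hlam_top.eventually_gt_atTop 0)).mono fun r hr => ?_
      have hl : (0 : ℝ) < lam r := by exact_mod_cast hr.2
      have := Nat.le_ceil (-Real.log r)
      rw [← lam_not r hr.1] at this
      rw [le_div_iff₀ hl]
      linarith
    have hmin : 0 < min (Real.log ξ / 2) (1 / 2 : ℝ) := lt_min (half_pos hlogξ) (by norm_num)
    refine lt_of_le_of_lt (limsup_le_of_le ?_ hup) (neg_lt_zero.mpr hmin)
    exact IsCobounded.of_frequently_ge hfreq
  · have hlim : Tendsto (fun n => 2 * D n) atTop (𝓝[>] (0 : ℝ)) := by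
      refine tendsto_nhdsWithin_iff.mpr
        ⟨?_, Eventually.of_forall fun n => mul_pos two_pos (hpos n)⟩
      have h0 : Tendsto (fun n : ℕ => (ξ ^ n)⁻¹) atTop (𝓝 0) :=
        tendsto_inv_atTop_zero.comp (tendsto_pow_atTop_atTop_of_one_lt hξ)
      simpa using (squeeze_zero' (Eventually.of_forall fun n => (hpos n).le) hle h0).const_mul 2
    refine lt_of_lt_of_le (show (0 : ENNReal) < 2⁻¹ by simp)
      (le_limsup_of_frequently_le (hlim.frequently (Frequently.of_forall fun n => ?_)))
    set r := 2 * D n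
    have hDr : 2 * D (lam r) = r := lam_of r ⟨n, rfl⟩
    have hr0 : 0 < r := mul_pos two_pos (hpos n)
    have hS : ifsWord g (τ (lam r)) '' Icc 0 1 ∈ cylinderFamily g y (lam r) r := by
      refine ⟨τ (lam r), rfl, fun z hz => ?_⟩
      have := Metric.dist_le_diam_of_mem (hbdd _) hz (hmem (lam r))
      rw [Metric.mem_ball]
      linarith [hpos (lam r)]
    have hsum := ENNReal.le_tsum (f := fun S : cylinderFamily g y (lam r) r =>
      Metric.ediam (S : Set ℝ)) ⟨_, hS⟩
    refine le_trans ?_ (mul_le_mul_right hsum _)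
    have hdiam : ENNReal.ofReal r * 2⁻¹ ≤
        Metric.ediam (ifsWord g (τ (lam r)) '' Icc 0 1) := by
      have h2 : ENNReal.ofReal r * 2⁻¹ = ENNReal.ofReal (D (lam r)) := by
        rw [show D (lam r) = r / 2 by linarith, ENNReal.ofReal_div_of_pos two_pos,
          div_eq_mul_inv, ENNReal.ofReal_ofNat]
      rw [h2]
      exact ENNReal.ofReal_toReal_le
    refine le_trans (le_of_eq ?_) (mul_le_mul_right hdiam _)
    rw [← mul_assoc, ENNReal.inv_mul_cancel (by simpa using hr0) ENNReal.ofReal_ne_top, one_mul]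

/-- The iterated function system associated to an expanding Markov map has positive upper
cylinder density at every point of the repeller. -/
theorem hasPUCD_of_mem_repeller {A : Type} (M : ExpandingMarkovMap A)
    (g : A → ℝ → ℝ) (hg : M.IsIFS g) (y : ℝ) (hy : y ∈ M.repeller) :
    HasPUCD g y := by
  choose w hw using fun n => mem_iUnion.mp (hy n)
  obtain ⟨ξ, hξ, N, hN⟩ := M.expanding
  refine hasPUCD_of_cylinders (fun n ν => w ν) (fun n => hg.isBounded_ifsWord _)
    (fun n => hg.diam_ifsWord_pos _)
    (fun n => ⟨M.T^[n] y, M.V_subset _ (hw n), hg.ifsWord_iterate _ fun ν => hw ν⟩) hξ ?_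
  filter_upwards [eventually_ge_atTop N] with n hn
  exact hg.diam_ifsWord_le _ (pow_pos (one_pos.trans hξ) n) fun x hx => hN n hn _ x hx
end
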